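/- Let (Ω₂,ℙ₂) be a probability space, let p with 1 < p ≤ ∞ and C > 0, and let (W_n) be a sequence of P-variables W_n : [0,1] × [0,1] × Ω₂ → ℝ ([0,1] with Lebesgue measure) with ‖W_n‖_p ≤ C for every n. If (W_n) is a Cauchy sequence in the P-variables metric d_M, then the sequence (w_n) of contractions w_n(x₁,x₂) = ∫_{Ω₂} W_n(x₁,x₂,x₁₂) dℙ₂(x₁₂) is a Cauchy sequence in the real-valued cut distance δ_{□,ℝ}. -/

import Mathlib

set_option autoImplicit false

open MeasureTheory Set
open scoped ENNReal NNReal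

noncomputable section

/-- `ℝ^n` with the Euclidean metric. -/
abbrev RE (n : ℕ) : Type := EuclideanSpace ℝ (Fin n)

/-- The random vector `(f₁(x₁), f₁(x₂), …, f_k(x₁), f_k(x₂), W(x₁,x₂,x₁₂))`. -/
def sVec {Ω₁ Ω₂ : Type*} (k : ℕ) (f : Fin k → Ω₁ → ℝ)
    (W : Ω₁ × Ω₁ × Ω₂ → ℝ) (x : Ω₁ × Ω₁ × Ω₂) : RE (2 * k + 1) :=
  (WithLp.equiv 2 (Fin (2 * k + 1) → ℝ)).symm fun i =>
    if _ : (i : ℕ) < 2 * k then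
      if (i : ℕ) % 2 = 0 then f ⟨(i : ℕ) / 2, by omega⟩ x.1
      else f ⟨(i : ℕ) / 2, by omega⟩ x.2.1
    else W x

/-- `S(f₁,…,f_k,W)`: the pushforward of the product measure `P₁ ⊗ P₁ ⊗ P₂` under `sVec`. -/
def Smeasure {Ω₁ Ω₂ : Type*} [MeasurableSpace Ω₁] [MeasurableSpace Ω₂]
    (P₁ : Measure Ω₁) (P₂ : Measure Ω₂) {k : ℕ} (f : Fin k → Ω₁ → ℝ)
    (W : Ω₁ × Ω₁ × Ω₂ → ℝ) : Measure (RE (2 * k + 1)) :=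
  (P₁.prod (P₁.prod P₂)).map (sVec k f W)

/-- The `k`-profile `S_k(W)`. -/
def SkSet {Ω₁ Ω₂ : Type*} [MeasurableSpace Ω₁] [MeasurableSpace Ω₂]
    (P₁ : Measure Ω₁) (P₂ : Measure Ω₂) (k : ℕ)
    (W : Ω₁ × Ω₁ × Ω₂ → ℝ) : Set (Measure (RE (2 * k + 1))) :=
  {μ | ∃ f : Fin k → Ω₁ → ℝ, (∀ i, Measurable (f i)) ∧
    (∀ i x, f i x ∈ Icc (-1 : ℝ) 1) ∧ μ = Smeasure P₁ P₂ f W}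

/-- A function partition: `{0,1}`-valued measurable functions summing to `1`. -/
def IsFunctionPartition {Ω₁ : Type*} [MeasurableSpace Ω₁] {k : ℕ}
    (f : Fin k → Ω₁ → ℝ) : Prop :=
  (∀ i, Measurable (f i)) ∧ (∀ i x, f i x = 0 ∨ f i x = 1) ∧ ∀ x, ∑ i, f i x = 1

/-- The restricted `k`-profile `S'_k(W)`. -/
def SkSet' {Ω₁ Ω₂ : Type*} [MeasurableSpace Ω₁] [MeasurableSpace Ω₂]
    (P₁ : Measure Ω₁) (P₂ : Measure Ω₂) (k : ℕ)
    (W : Ω₁ × Ω₁ × Ω₂ → ℝ) : Set (Measure (RE (2 * k + 1))) :=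
  {μ | ∃ f : Fin k → Ω₁ → ℝ, IsFunctionPartition f ∧ μ = Smeasure P₁ P₂ f W}

/-- Hausdorff edistance (w.r.t. the Lévy–Prokhorov distance) between sets of measures. -/
def eHausLP {X : Type*} [MeasurableSpace X] [PseudoEMetricSpace X]
    (A B : Set (Measure X)) : ℝ≥0∞ :=
  max (⨆ μ ∈ A, ⨅ ν ∈ B, levyProkhorovEDist μ ν)
      (⨆ ν ∈ B, ⨅ μ ∈ A, levyProkhorovEDist μ ν)

/-- Hausdorff distance (w.r.t. the Lévy–Prokhorov distance) between sets of measures. -/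
def dHLP {X : Type*} [MeasurableSpace X] [PseudoEMetricSpace X]
    (A B : Set (Measure X)) : ℝ := (eHausLP A B).toReal

/-- A `P`-variable: a measurable real-valued function on a product `Ω₁ × Ω₁ × Ω₂`
of probability spaces. -/
structure PVar where
  (Ω₁ : Type*)
  (Ω₂ : Type*)
  [m₁ : MeasurableSpace Ω₁]
  [m₂ : MeasurableSpace Ω₂]
  (P₁ : Measure Ω₁)
  (P₂ : Measure Ω₂)
  (prob₁ : IsProbabilityMeasure P₁)
  (prob₂ : IsProbabilityMeasure P₂)
  (W : Ω₁ × Ω₁ × Ω₂ → ℝ)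
  (meas : Measurable W)

attribute [instance] PVar.m₁ PVar.m₂

/-- The underlying product probability measure of a `P`-variable. -/
def PVar.vol (V : PVar) : Measure (V.Ω₁ × V.Ω₁ × V.Ω₂) := V.P₁.prod (V.P₁.prod V.P₂)

/-- The `k`-profile of a `P`-variable. -/
def PVar.Sk (V : PVar) (k : ℕ) : Set (Measure (RE (2 * k + 1))) := SkSet V.P₁ V.P₂ k V.W

/-- The restricted `k`-profile of a `P`-variable. -/
def PVar.Sk' (V : PVar) (k : ℕ) : Set (Measure (RE (2 * k + 1))) := SkSet' V.P₁ V.P₂ k V.W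

/-- The `P`-variables metric `d_M`. -/
def dM (V U : PVar) : ℝ :=
  ∑' k : ℕ, (2 : ℝ)⁻¹ ^ (k + 1) * dHLP (V.Sk (k + 1)) (U.Sk (k + 1))


/-- The probability graphon (Markov kernel `[0,1]² → 𝒫(ℝ)`) associated to a
P-variable on `[0,1] × [0,1] × Ω₂`: `W̃(x₁,x₂;·)` is the law of `W(x₁,x₂,·)`. -/
def assocGraphon {Ω₂ : Type*} [MeasurableSpace Ω₂] (P₂ : Measure Ω₂)
    (W : unitInterval × unitInterval × Ω₂ → ℝ)
    (x : unitInterval × unitInterval) : Measure ℝ :=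
  P₂.map fun ω => W (x.1, x.2, ω)

/-- `W̃(A;·) = ∫_A W̃(x,y;·) dx dy` for measurable `A ⊆ [0,1]²`. -/
def graphonInt (K : unitInterval × unitInterval → Measure ℝ)
    (A : Set (unitInterval × unitInterval)) : Measure ℝ :=
  (((volume : Measure unitInterval).prod volume).restrict A).bind K

/-- The cut semidistance `d_□` between two probability graphons on `[0,1]`:
`sup_{S,T} d_LP(K(S×T;·), L(S×T;·))` over measurable `S, T ⊆ [0,1]`. -/
def cutDistKer (K L : unitInterval × unitInterval → Measure ℝ) : ℝ :=
  ⨆ p : {S : Set unitInterval // MeasurableSet S} ×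
        {T : Set unitInterval // MeasurableSet T},
    levyProkhorovDist (graphonInt K (p.1.1 ×ˢ p.2.1)) (graphonInt L (p.1.1 ×ˢ p.2.1))

/-- The unlabelled cut distance `δ_□`: infimum of `d_□(K, L∘(φ×φ))` over
Lebesgue-measure-preserving bijections `φ` of `[0,1]`. -/
def unlabCutDist (K L : unitInterval × unitInterval → Measure ℝ) : ℝ :=
  ⨅ φ : {φ : unitInterval ≃ᵐ unitInterval //
          MeasurePreserving φ (volume : Measure unitInterval) volume},
    cutDistKer K fun x => L (φ.1 x.1, φ.1 x.2)

/-- A P-variable on `[0,1] × [0,1] × Ω₂` (with Lebesgue measure on `[0,1]`),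
bundled as a `PVar`. -/
def PVar.ofUnitInterval {Ω₂ : Type*} [MeasurableSpace Ω₂] (P₂ : Measure Ω₂)
    [h₂ : IsProbabilityMeasure P₂] (W : unitInterval × unitInterval × Ω₂ → ℝ)
    (hW : Measurable W) : PVar :=
  ⟨unitInterval, Ω₂, (volume : Measure unitInterval), P₂, inferInstance, h₂, W, hW⟩

/-- The contraction of a P-variable on `[0,1] × [0,1] × Ω₂`:
`w(x₁,x₂) = ∫_{Ω₂} W(x₁,x₂,x₁₂) dℙ₂(x₁₂)`. -/
def contraction {Ω₂ : Type*} [MeasurableSpace Ω₂] (P₂ : Measure Ω₂)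
    (W : unitInterval × unitInterval × Ω₂ → ℝ)
    (x : unitInterval × unitInterval) : ℝ :=
  ∫ ω, W (x.1, x.2, ω) ∂P₂

/-- The real-valued cut norm `‖u‖_{□,ℝ} = sup_{S,T} |∫_{S×T} u|` over measurable
`S, T ⊆ [0,1]`. -/
def cutNormR (u : unitInterval × unitInterval → ℝ) : ℝ :=
  ⨆ p : {S : Set unitInterval // MeasurableSet S} ×
        {T : Set unitInterval // MeasurableSet T},
    |∫ x in p.1.1 ×ˢ p.2.1, u x ∂((volume : Measure unitInterval).prod volume)|

/-- The real-valued cut distance `δ_{□,ℝ}(u,w) = inf_φ ‖u − w∘(φ×φ)‖_{□,ℝ}` over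
Lebesgue-measure-preserving bijections `φ` of `[0,1]`. -/
def cutDistR (u w : unitInterval × unitInterval → ℝ) : ℝ :=
  ⨅ φ : {φ : unitInterval ≃ᵐ unitInterval //
          MeasurePreserving φ (volume : Measure unitInterval) volume},
    cutNormR fun x => u x - w (φ.1 x.1, φ.1 x.2)


theorem lp_integral_nonneg {X : Type*} [MeasurableSpace X] [PseudoMetricSpace X]
    [OpensMeasurableSpace X] (μ ν : Measure X) [IsProbabilityMeasure μ] [IsProbabilityMeasure ν]
    {δ η : ℝ} (hδ : 0 < δ) (hη : 0 ≤ η) (h : levyProkhorovEDist μ ν < ENNReal.ofReal δ)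
    (g : BoundedContinuousFunction X ℝ) (hg : ∀ x, 0 ≤ g x)
    (hu : ∀ x y, dist x y < δ → |g x - g y| ≤ η) :
    ∫ x, g x ∂μ ≤ ∫ x, g x ∂ν + η + δ * ‖g‖ := by
  have h1 := BoundedContinuousFunction.integral_le_of_levyProkhorovEDist_lt μ ν hδ h g
    (Filter.Eventually.of_forall hg)
  set g' : BoundedContinuousFunction X ℝ := g + BoundedContinuousFunction.const X η with hg'
  have hg'x : ∀ x, g' x = g x + η := fun x => by simp [hg']
  have hg'0 : ∀ x, 0 ≤ g' x := fun x => by rw [hg'x]; linarith [hg x]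
  have h2 := BoundedContinuousFunction.integral_eq_integral_meas_le g' ν
    (Filter.Eventually.of_forall hg'0)
  have h3 : ∫ x, g' x ∂ν = ∫ x, g x ∂ν + η := by
    simp_rw [hg'x]
    rw [integral_add (g.integrable ν) (integrable_const _)]
    simp
  have hnorm : ‖g‖ ≤ ‖g'‖ := by
    refine (BoundedContinuousFunction.norm_le (norm_nonneg _)).2 fun x => ?_
    rw [Real.norm_of_nonneg (hg x)]
    calc g x ≤ g' x := by rw [hg'x]; linarith
      _ ≤ ‖g' x‖ := Real.le_norm_self _
      _ ≤ ‖g'‖ := g'.norm_coe_le_norm x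
  have anti1 : Antitone fun t : ℝ => ν.real (Metric.thickening δ {a | t ≤ g a}) := by
    intro s t hst
    refine measureReal_mono (Metric.thickening_subset_of_subset _ ?_)
    intro a ha; exact le_trans hst ha
  have anti2 : Antitone fun t : ℝ => ν.real {a | t ≤ g' a} := by
    intro s t hst
    refine measureReal_mono ?_
    intro a ha; exact le_trans hst ha
  have int1 : ∀ b : ℝ, IntegrableOn (fun t : ℝ => ν.real (Metric.thickening δ {a | t ≤ g a}))
      (Ioc 0 b) := fun b =>
    ((anti1.antitoneOn _).integrableOn_isCompact isCompact_Icc).mono_set Ioc_subset_Icc_self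
  have int2 : ∀ b : ℝ, IntegrableOn (fun t : ℝ => ν.real {a | t ≤ g' a})
      (Ioc 0 b) := fun b =>
    ((anti2.antitoneOn _).integrableOn_isCompact isCompact_Icc).mono_set Ioc_subset_Icc_self
  have h4 : ∫ t in Ioc 0 ‖g‖, ν.real (Metric.thickening δ {a | t ≤ g a})
      ≤ ∫ t in Ioc 0 ‖g'‖, ν.real {a | t ≤ g' a} := by
    calc _ ≤ ∫ t in Ioc 0 ‖g‖, ν.real {a | t ≤ g' a} := by
          refine setIntegral_mono (int1 _) (int2 _) fun t => measureReal_mono ?_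
          intro a ha
          obtain ⟨b, hb, hab⟩ := Metric.mem_thickening_iff.1 ha
          have := abs_le.1 (hu a b hab)
          simp only [mem_ofPred_eq] at hb ⊢
          rw [hg'x]; linarith [this.1]
      _ ≤ _ := by
          refine setIntegral_mono_set (int2 _) ?_ ?_
          · exact Filter.Eventually.of_forall fun t => measureReal_nonneg
          · exact (Ioc_subset_Ioc_right hnorm).eventuallyLE
  linarith

theorem lp_integral {X : Type*} [MeasurableSpace X] [PseudoMetricSpace X]
    [OpensMeasurableSpace X] (μ ν : Measure X) [IsProbabilityMeasure μ] [IsProbabilityMeasure ν]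
    {δ η B : ℝ} (hδ : 0 < δ) (hη : 0 ≤ η) (h : levyProkhorovEDist μ ν < ENNReal.ofReal δ)
    (g : X → ℝ) (hc : Continuous g) (hg : ∀ x, |g x| ≤ B)
    (hu : ∀ x y, dist x y < δ → |g x - g y| ≤ η) :
    ∫ x, g x ∂μ ≤ ∫ x, g x ∂ν + η + δ * (2 * B) := by
  set g' : BoundedContinuousFunction X ℝ := BoundedContinuousFunction.ofNormedAddCommGroup
    (fun x => g x + B) (by fun_prop) (2 * B) (fun x => by
      have := hg x
      have h2 := abs_le.1 this
      rw [Real.norm_eq_abs, abs_le]; constructor <;> linarith [h2.1, h2.2]) with hg'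
  have hg'x : ∀ x, g' x = g x + B := fun x => rfl
  obtain ⟨x0⟩ : Nonempty X := nonempty_of_isProbabilityMeasure μ
  have hB : 0 ≤ B := (abs_nonneg _).trans (hg x0)
  have hn : ‖g'‖ ≤ 2 * B := BoundedContinuousFunction.norm_ofNormedAddCommGroup_le _ (by linarith) _
  have key := lp_integral_nonneg μ ν hδ hη h g' (fun x => by
    rw [hg'x]; linarith [(abs_le.1 (hg x)).1]) (fun x y hxy => by
    rw [hg'x, hg'x]; simpa using hu x y hxy)
  have e : ∀ (κ : Measure X) [IsProbabilityMeasure κ], ∫ x, g' x ∂κ = ∫ x, g x ∂κ + B := by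
    intro κ _
    have : ∀ x, g x = g' x - B := fun x => by rw [hg'x]; ring
    simp_rw [this]
    rw [integral_sub (g'.integrable κ) (integrable_const _)]
    simp
  rw [e, e] at key
  have : δ * ‖g'‖ ≤ δ * (2 * B) := by gcongr
  linarith

theorem energy_level (E : ℕ → ℕ → ℝ) (B : ℝ) (h0 : ∀ n, 0 ≤ E 0 n) (hB : ∀ k n, E k n ≤ B)
    (hst : ∀ k, ∀ η > (0 : ℝ), ∃ N, ∀ m ≥ N, ∀ n ≥ N, E k m ≤ E k n + η) (η : ℝ) (hη : 0 < η) :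
    ∃ k N, ∀ m ≥ N, ∀ n ≥ N, E (k + 1) m ≤ E k n + η := by
  by_contra! hcon
  have key : ∀ k : ℕ, ∃ N, ∀ n ≥ N, k * (η / 2) ≤ E k n := by
    intro k
    induction k with
    | zero => exact ⟨0, fun n _ => by simpa using h0 n⟩
    | succ k ih =>
      obtain ⟨N, hN⟩ := ih
      obtain ⟨N1, hN1⟩ := hst (k + 1) (η / 2) (by linarith)
      obtain ⟨m, hm, n, hn, hmn⟩ := hcon k (max N N1)
      refine ⟨max N N1, fun l hl => ?_⟩
      have h1 := hN n (le_trans (le_max_left _ _) hn)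
      have h2 := hN1 m (le_trans (le_max_right _ _) hm) l (le_trans (le_max_right _ _) hl)
      push_cast
      linarith
  obtain ⟨k, hk⟩ := exists_nat_gt (B / (η / 2))
  obtain ⟨N, hN⟩ := key k
  have h1 := hN N le_rfl
  have h2 := hB k N
  rw [div_lt_iff₀ (by linarith)] at hk
  linarith

theorem finite_matching {V : Type*} [DecidableEq V] {N : ℕ} (A B : Fin N → V) :
    ∃ σ : Equiv.Perm (Fin N), ∀ v, (∀ i, A i = v → B (σ i) = v) ∨ (∀ i, B (σ i) = v → A i = v) := by
  obtain ⟨σ, -, hσ⟩ := Finset.exists_max_image (Finset.univ : Finset (Equiv.Perm (Fin N)))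
    (fun σ => (Finset.univ.filter fun i => A i = B (σ i)).card) ⟨1, Finset.mem_univ _⟩
  refine ⟨σ, fun v => ?_⟩
  by_contra! hcon
  obtain ⟨⟨i, hi, hi'⟩, ⟨j, hj, hj'⟩⟩ := hcon
  have h1 := hσ (σ * Equiv.swap i j) (Finset.mem_univ _)
  refine absurd h1 (not_le.2 (Finset.card_lt_card ?_))
  rw [Finset.ssubset_iff_of_subset]
  · refine ⟨i, ?_, ?_⟩
    · refine Finset.mem_filter.2 ⟨Finset.mem_univ _, ?_⟩
      simp [hi, hj]
    · simp only [Finset.mem_filter, Finset.mem_univ, true_and]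
      rw [hi]; exact fun h => hi' h.symm
  · intro l hl
    simp only [Finset.mem_filter, Finset.mem_univ, true_and] at hl
    refine Finset.mem_filter.2 ⟨Finset.mem_univ _, ?_⟩
    rw [Equiv.Perm.mul_apply]
    have hli : l ≠ i := by
      rintro rfl; exact hi' (by rw [← hl, hi])
    have hlj : l ≠ j := by
      rintro rfl; exact hj' (by rw [hl, hj])
    rw [Equiv.swap_apply_of_ne_of_ne hli hlj]; exact hl

theorem finite_matching_count {V : Type*} [DecidableEq V] [Fintype V] {N : ℕ} (A B : Fin N → V)
    (c : ℝ) (hc : 0 ≤ c)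
    (h : ∀ v, ((Finset.univ.filter fun i => A i = v).card : ℝ)
      ≤ (Finset.univ.filter fun i => B i = v).card + c) :
    ∃ σ : Equiv.Perm (Fin N),
      ((Finset.univ.filter fun i => A i ≠ B (σ i)).card : ℝ) ≤ Fintype.card V * c := by
  obtain ⟨σ, hσ⟩ := finite_matching A B
  refine ⟨σ, ?_⟩
  have h1 : (Finset.univ.filter fun i => A i ≠ B (σ i)).card
      = ∑ v : V, ((Finset.univ.filter fun i => A i ≠ B (σ i)).filter fun i => A i = v).card :=
    Finset.card_eq_sum_card_fiberwise (fun _ _ => Finset.mem_coe.2 (Finset.mem_univ _))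
  rw [h1]
  push_cast
  calc _ ≤ ∑ v : V, c := Finset.sum_le_sum fun v _ => ?_
    _ = _ := by simp
  rcases hσ v with h2 | h2
  · rw [Finset.card_eq_zero.2]
    · simpa using hc
    · rw [Finset.filter_eq_empty_iff]
      intro i hi hv
      simp only [Finset.mem_filter, Finset.mem_univ, true_and] at hi
      exact hi (by rw [h2 i hv, hv])
  · have e : (Finset.univ.filter fun i => B i = v).card
        = (Finset.univ.filter fun i => B (σ i) = v).card := by
      refine (Finset.card_bij (fun i _ => σ i) ?_ ?_ ?_).symm
      · intro a ha; simpa using ha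
      · intro a _ b _ hab; exact σ.injective hab
      · intro b hb; exact ⟨σ.symm b, by simpa using hb, by simp⟩
    have h3 : ((Finset.univ.filter fun i => A i ≠ B (σ i)).filter fun i => A i = v).card
        + (Finset.univ.filter fun i => B (σ i) = v).card
        ≤ (Finset.univ.filter fun i => A i = v).card := by
      rw [← Finset.card_union_of_disjoint]
      · refine Finset.card_le_card ?_
        intro i hi
        simp only [Finset.mem_union, Finset.mem_filter, Finset.mem_univ, true_and] at hi ⊢
        rcases hi with hi | hi
        · exact hi.2
        · exact h2 i hi
      · rw [Finset.disjoint_left]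
        intro i hi hi'
        simp only [Finset.mem_filter, Finset.mem_univ, true_and] at hi hi'
        exact hi.1 (by rw [hi.2, hi'])
    have h4 := h v
    rw [e] at h4
    have h5 : (((Finset.univ.filter fun i => A i ≠ B (σ i)).filter fun i => A i = v).card : ℝ)
        + ((Finset.univ.filter fun i => B (σ i) = v).card : ℝ)
        ≤ ((Finset.univ.filter fun i => A i = v).card : ℝ) := by exact_mod_cast h3
    linarith



/-- index of the interval of length `1/N` containing `x` -/
def cell (N : ℕ) (hN : 0 < N) (x : unitInterval) : Fin N :=
  ⟨min ⌊(N : ℝ) * (x : ℝ)⌋₊ (N - 1), by omega⟩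

theorem cell_measurable (N : ℕ) (hN : 0 < N) : Measurable (cell N hN) := by
  have h1 : Measurable fun x : unitInterval => ⌊(N : ℝ) * (x : ℝ)⌋₊ :=
    Nat.measurable_floor.comp (measurable_subtype_coe.const_mul _)
  have h2 : Measurable fun n : ℕ => (⟨min n (N - 1), by omega⟩ : Fin N) := measurable_from_nat
  exact h2.comp h1

theorem cell_spec (N : ℕ) (hN : 0 < N) (x : unitInterval) (hx : (x : ℝ) < 1) :
    ((cell N hN x : ℕ) : ℝ) ≤ N * x ∧ (N : ℝ) * x < (cell N hN x : ℕ) + 1 := by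
  have hN' : (0 : ℝ) < N := by exact_mod_cast hN
  have h0 : 0 ≤ (N : ℝ) * x := mul_nonneg hN'.le x.2.1
  have h1 : ⌊(N : ℝ) * (x : ℝ)⌋₊ < N := by
    rw [Nat.floor_lt h0]; nlinarith
  have h2 : (cell N hN x : ℕ) = ⌊(N : ℝ) * (x : ℝ)⌋₊ := by
    simp only [cell]; omega
  rw [h2]
  exact ⟨Nat.floor_le h0, Nat.lt_floor_add_one _⟩

theorem cell_eq (N : ℕ) (hN : 0 < N) (x : unitInterval) (c : Fin N)
    (h1 : ((c : ℕ) : ℝ) ≤ N * x) (h2 : (N : ℝ) * x < (c : ℕ) + 1) : cell N hN x = c := by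
  have h3 : ⌊(N : ℝ) * (x : ℝ)⌋₊ = c := by
    rw [Nat.floor_eq_iff (le_trans (by positivity) h1)]; exact ⟨h1, h2⟩
  ext
  simp only [cell, h3]
  have := c.2
  omega

theorem cell_dist (N : ℕ) (hN : 0 < N) (x : unitInterval) :
    |(x : ℝ) - ((cell N hN x : ℕ) : ℝ) / N| ≤ 1 / N := by
  have hN' : (0 : ℝ) < N := by exact_mod_cast hN
  rcases lt_or_eq_of_le x.2.2 with hx | hx
  · obtain ⟨h1, h2⟩ := cell_spec N hN x hx
    have e : (x : ℝ) - ((cell N hN x : ℕ) : ℝ) / N = (N * x - (cell N hN x : ℕ)) / N := by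
      field_simp
    rw [e, abs_of_nonneg (div_nonneg (by linarith) hN'.le)]
    gcongr
    linarith
  · have : (cell N hN x : ℕ) = N - 1 := by
      simp only [cell, hx, mul_one, Nat.floor_natCast]; omega
    rw [this, hx, Nat.cast_sub (by omega)]
    have e : (1 : ℝ) - ((N : ℝ) - (1 : ℕ)) / N = 1 / N := by
      field_simp; push_cast; ring
    rw [e, abs_of_nonneg (by positivity)]

theorem volume_one_unitInterval :
    (volume : Measure unitInterval) {x : unitInterval | (x : ℝ) = 1} = 0 := by
  have : {x : unitInterval | (x : ℝ) = 1} = {1} := by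
    ext x
    exact ⟨fun h => Subtype.ext h, fun h => congrArg Subtype.val h⟩
  rw [this]; exact measure_singleton _

theorem ae_lt_one : ∀ᵐ x : unitInterval ∂(volume : Measure unitInterval), (x : ℝ) < 1 := by
  have : {x : unitInterval | ¬ ((x : ℝ) < 1)} = {x : unitInterval | (x : ℝ) = 1} := by
    ext x; simp only [mem_ofPred_eq, not_lt]
    exact ⟨fun h => le_antisymm x.2.2 h, fun h => h.ge⟩
  rw [ae_iff, this]; exact volume_one_unitInterval

theorem cell_volume (N : ℕ) (hN : 0 < N) (c : Fin N) :
    (volume : Measure unitInterval).real {x | cell N hN x = c} = 1 / N := by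
  have hN' : (0 : ℝ) < N := by exact_mod_cast hN
  have hc : ((c : ℕ) : ℝ) + 1 ≤ N := by exact_mod_cast c.2
  let a : unitInterval := ⟨(c : ℕ) / N, by positivity, by
    rw [div_le_one hN']; linarith⟩
  let b : unitInterval := ⟨((c : ℕ) + 1) / N, by positivity, by
    rw [div_le_one hN']; linarith⟩
  have h1 : (volume : Measure unitInterval).real {x | cell N hN x = c}
      = (volume : Measure unitInterval).real (Ico a b) := by
    refine measureReal_congr ?_
    filter_upwards [ae_lt_one] with x hx
    obtain ⟨h1, h2⟩ := cell_spec N hN x hx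
    refine propext ⟨?_, ?_⟩
    · intro (h : cell N hN x = c)
      rw [h] at h1 h2
      refine ⟨Subtype.coe_le_coe.1 ?_, Subtype.coe_lt_coe.1 ?_⟩
      · change ((c : ℕ) : ℝ) / N ≤ x
        rw [div_le_iff₀ hN']; linarith
      · change (x : ℝ) < ((c : ℕ) + 1) / N
        rw [lt_div_iff₀ hN']; linarith
    · rintro ⟨h3, h4⟩
      have h3' : ((c : ℕ) : ℝ) / N ≤ x := h3
      have h4' : (x : ℝ) < ((c : ℕ) + 1) / N := h4
      rw [div_le_iff₀ hN'] at h3'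
      rw [lt_div_iff₀ hN'] at h4'
      exact cell_eq N hN x c (by linarith) (by linarith)
  rw [h1, measureReal_def, unitInterval.volume_Ico, ENNReal.toReal_ofReal]
  · change ((c : ℕ) + 1 : ℝ) / N - (c : ℕ) / N = 1 / N
    field_simp; ring
  · change 0 ≤ ((c : ℕ) + 1 : ℝ) / N - (c : ℕ) / N
    have : ((c : ℕ) + 1 : ℝ) / N - (c : ℕ) / N = 1 / N := by field_simp; ring
    rw [this]; positivity

theorem cell_volume_set (N : ℕ) (hN : 0 < N) (P : Fin N → Prop) [DecidablePred P] :
    (volume : Measure unitInterval).real {x | P (cell N hN x)}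
      = ((Finset.univ.filter P).card : ℝ) / N := by
  have h1 : {x | P (cell N hN x)} = ⋃ c ∈ Finset.univ.filter P, {x | cell N hN x = c} := by
    ext x; simp
  rw [h1, measureReal_biUnion_finset]
  · simp_rw [cell_volume]; simp; ring
  · intro c _ d _ hcd
    refine Set.disjoint_left.2 fun x hx hx' => hcd ?_
    exact (show cell N hN x = c from hx).symm.trans hx'
  · intro c _
    exact cell_measurable N hN (measurableSet_singleton c)

theorem iex_mem (N : ℕ) (hN : 0 < N) (σ : Equiv.Perm (Fin N)) (x : unitInterval)
    (hx : (x : ℝ) < 1) :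
    (x : ℝ) + (((σ (cell N hN x) : ℕ) : ℝ) - (cell N hN x : ℕ)) / N ∈ unitInterval := by
  have hN' : (0 : ℝ) < N := by exact_mod_cast hN
  obtain ⟨h1, h2⟩ := cell_spec N hN x hx
  have hc : ((σ (cell N hN x) : ℕ) : ℝ) + 1 ≤ N := by exact_mod_cast (σ (cell N hN x)).2
  have e : (x : ℝ) + (((σ (cell N hN x) : ℕ) : ℝ) - (cell N hN x : ℕ)) / N
      = (N * x + (((σ (cell N hN x) : ℕ) : ℝ) - (cell N hN x : ℕ))) / N := by
    field_simp
  have h0 : (0 : ℝ) ≤ (σ (cell N hN x) : ℕ) := by positivity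
  rw [e]
  constructor
  · exact div_nonneg (by linarith) hN'.le
  · rw [div_le_one hN']; linarith

open Classical in
/-- the interval exchange associated to a permutation of the `N` intervals -/
def iex (N : ℕ) (hN : 0 < N) (σ : Equiv.Perm (Fin N)) (x : unitInterval) : unitInterval :=
  if hx : (x : ℝ) < 1 then
    ⟨(x : ℝ) + (((σ (cell N hN x) : ℕ) : ℝ) - (cell N hN x : ℕ)) / N, iex_mem N hN σ x hx⟩
  else x

theorem iex_coe (N : ℕ) (hN : 0 < N) (σ : Equiv.Perm (Fin N)) (x : unitInterval)
    (hx : (x : ℝ) < 1) : (iex N hN σ x : ℝ) =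
      (x : ℝ) + (((σ (cell N hN x) : ℕ) : ℝ) - (cell N hN x : ℕ)) / N := by
  simp [iex, hx]

theorem iex_spec (N : ℕ) (hN : 0 < N) (σ : Equiv.Perm (Fin N)) (x : unitInterval)
    (hx : (x : ℝ) < 1) : (iex N hN σ x : ℝ) < 1 ∧ cell N hN (iex N hN σ x) = σ (cell N hN x) := by
  have hN' : (0 : ℝ) < N := by exact_mod_cast hN
  obtain ⟨h1, h2⟩ := cell_spec N hN x hx
  have hc : ((σ (cell N hN x) : ℕ) : ℝ) + 1 ≤ N := by exact_mod_cast (σ (cell N hN x)).2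
  have e : (N : ℝ) * (iex N hN σ x : ℝ)
      = N * x + (((σ (cell N hN x) : ℕ) : ℝ) - (cell N hN x : ℕ)) := by
    rw [iex_coe N hN σ x hx]
    field_simp
  constructor
  · have : (N : ℝ) * (iex N hN σ x : ℝ) < N * 1 := by linarith
    exact lt_of_mul_lt_mul_left this hN'.le
  · exact cell_eq N hN _ _ (by linarith) (by linarith)

theorem iex_inv (N : ℕ) (hN : 0 < N) (σ : Equiv.Perm (Fin N)) (x : unitInterval) :
    iex N hN σ.symm (iex N hN σ x) = x := by
  by_cases hx : (x : ℝ) < 1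
  · obtain ⟨h1, h2⟩ := iex_spec N hN σ x hx
    ext
    rw [iex_coe _ _ _ _ h1, h2, iex_coe _ _ _ _ hx]
    simp only [Equiv.symm_apply_apply]
    ring
  · simp [iex, hx]

theorem iex_measurable (N : ℕ) (hN : 0 < N) (σ : Equiv.Perm (Fin N)) :
    Measurable (iex N hN σ) := by
  classical
  have h : Measurable fun x => (iex N hN σ x : ℝ) := by
    have e : (fun x => (iex N hN σ x : ℝ)) = fun x : unitInterval => if (x : ℝ) < 1 then
      (x : ℝ) + (fun c : Fin N => (((σ c : ℕ) : ℝ) - (c : ℕ)) / N) (cell N hN x) else x := by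
      ext x
      by_cases hx : (x : ℝ) < 1
      · rw [iex_coe _ _ _ _ hx]; simp [hx]
      · simp [iex, hx]
    rw [e]
    refine Measurable.ite (measurableSet_lt measurable_subtype_coe measurable_const) ?_
      measurable_subtype_coe
    exact measurable_subtype_coe.add ((measurable_of_finite
      (fun c : Fin N => (((σ c : ℕ) : ℝ) - (c : ℕ)) / N)).comp (cell_measurable N hN))
  exact h.subtype_mk

/-- the interval exchange as a measurable equivalence -/
def iexEquiv (N : ℕ) (hN : 0 < N) (σ : Equiv.Perm (Fin N)) : unitInterval ≃ᵐ unitInterval where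
  toFun := iex N hN σ
  invFun := iex N hN σ.symm
  left_inv := iex_inv N hN σ
  right_inv := fun x => by simpa using iex_inv N hN σ.symm x
  measurable_toFun := iex_measurable N hN σ
  measurable_invFun := iex_measurable N hN σ.symm

theorem iex_measurePreserving (N : ℕ) (hN : 0 < N) (σ : Equiv.Perm (Fin N)) :
    MeasurePreserving (iexEquiv N hN σ) (volume : Measure unitInterval) volume := by
  refine ⟨(iexEquiv N hN σ).measurable, ?_⟩
  have hm : Measurable (iexEquiv N hN σ) := (iexEquiv N hN σ).measurable
  have : IsProbabilityMeasure ((volume : Measure unitInterval).map (iexEquiv N hN σ)) :=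
    Measure.isProbabilityMeasure_map hm.aemeasurable
  refine Measure.eq_of_le_of_isProbabilityMeasure (Measure.le_iff.2 fun s hs => ?_)
  rw [Measure.map_apply hm hs]
  have hC : ∀ c, MeasurableSet {x : unitInterval | (x : ℝ) < 1 ∧ cell N hN x = c} := fun c =>
    (measurableSet_lt measurable_subtype_coe measurable_const).inter
      (cell_measurable N hN (measurableSet_singleton c))
  have key : ∀ c, (volume : Measure unitInterval)
      ((iexEquiv N hN σ) ⁻¹' s ∩ {x | (x : ℝ) < 1 ∧ cell N hN x = c})
      ≤ (volume : Measure unitInterval) (s ∩ {x | (x : ℝ) < 1 ∧ cell N hN x = σ c}) := by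
    intro c
    rw [unitInterval.volume_apply, unitInterval.volume_apply]
    refine le_trans ?_ (measure_preimage_add_right volume ((((σ c : ℕ) : ℝ) - (c : ℕ)) / N) _).le
    refine measure_mono ?_
    rintro _ ⟨x, ⟨hx1, hx2, hx3⟩, rfl⟩
    obtain ⟨h1, h2⟩ := iex_spec N hN σ x hx2
    refine ⟨iex N hN σ x, ⟨hx1, h1, by rw [h2, hx3]⟩, ?_⟩
    rw [iex_coe _ _ _ _ hx2, hx3]
  calc (volume : Measure unitInterval) ((iexEquiv N hN σ) ⁻¹' s)
      ≤ volume ({x : unitInterval | (x : ℝ) = 1} ∪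
        ⋃ c, ((iexEquiv N hN σ) ⁻¹' s ∩ {x | (x : ℝ) < 1 ∧ cell N hN x = c})) := by
        refine measure_mono fun x hx => ?_
        rcases lt_or_eq_of_le x.2.2 with h | h
        · right; exact mem_iUnion.2 ⟨cell N hN x, hx, h, rfl⟩
        · left; exact h
    _ ≤ volume {x : unitInterval | (x : ℝ) = 1} + ∑ c, volume
          ((iexEquiv N hN σ) ⁻¹' s ∩ {x | (x : ℝ) < 1 ∧ cell N hN x = c}) := by
        refine (measure_union_le _ _).trans ?_
        gcongr
        exact measure_iUnion_fintype_le _ _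
    _ ≤ ∑ c, volume (s ∩ {x | (x : ℝ) < 1 ∧ cell N hN x = σ c}) := by
        rw [volume_one_unitInterval, zero_add]
        exact Finset.sum_le_sum fun c _ => key c
    _ = ∑ c, volume (s ∩ {x | (x : ℝ) < 1 ∧ cell N hN x = c}) :=
        Equiv.sum_comp σ fun c => (volume : Measure unitInterval)
          (s ∩ {x | (x : ℝ) < 1 ∧ cell N hN x = c})
    _ = volume (⋃ c, (s ∩ {x | (x : ℝ) < 1 ∧ cell N hN x = c})) := by
        rw [measure_iUnion, tsum_fintype]
        · intro c d hcd
          refine Set.disjoint_left.2 fun x hx hx' => hcd ?_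
          exact hx.2.2.symm.trans hx'.2.2
        · exact fun c => hs.inter (hC c)
    _ ≤ volume s := measure_mono (iUnion_subset fun c => inter_subset_left)

theorem step_approx {V : Type*} [Fintype V] [MeasurableSpace V] [MeasurableSingletonClass V]
    (A : unitInterval → V) (hA : Measurable A) (δ : ℝ) (hδ : 0 < δ) :
    ∃ N0 : ℕ, ∀ N ≥ N0, ∀ hN : 0 < N, ∃ A' : Fin N → V,
      (volume : Measure unitInterval).real {x | A x ≠ A' (cell N hN x)} ≤ δ := by
  classical
  let e := Fintype.equivFin V
  let f : unitInterval → ℝ := fun x => ((e (A x) : ℕ) : ℝ)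
  have hf : Measurable f :=
    (measurable_of_finite fun v : V => ((e v : ℕ) : ℝ)).comp hA
  have hfi : Integrable f (volume : Measure unitInterval) := by
    refine Integrable.of_bound hf.aestronglyMeasurable (Fintype.card V) ?_
    refine Filter.Eventually.of_forall fun x => ?_
    rw [Real.norm_of_nonneg (by positivity)]
    have : (e (A x) : ℕ) ≤ Fintype.card V := (e (A x)).2.le
    change ((e (A x) : ℕ) : ℝ) ≤ _
    exact_mod_cast this
  obtain ⟨g, hg, hgi⟩ := hfi.exists_boundedContinuous_integral_sub_le (ε := δ / 4) (by linarith)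
  have hgu : UniformContinuous g := CompactSpace.uniformContinuous_of_continuous g.continuous
  obtain ⟨τ, hτ, hgτ⟩ := Metric.uniformContinuous_iff.1 hgu (1 / 4) (by norm_num)
  obtain ⟨N0, hN0⟩ := exists_nat_gt (1 / τ)
  refine ⟨N0, fun N hNN hN => ?_⟩
  have hN' : (0 : ℝ) < N := by exact_mod_cast hN
  have hNτ : 1 / (N : ℝ) < τ := by
    have : (N0 : ℝ) ≤ N := by exact_mod_cast hNN
    rw [div_lt_iff₀ hN']
    rw [div_lt_iff₀ hτ] at hN0
    nlinarith
  let pt : Fin N → unitInterval := fun c => ⟨(c : ℕ) / N, by positivity, by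
    rw [div_le_one hN']; exact_mod_cast c.2.le⟩
  let A' : Fin N → V := fun c =>
    if h : ∃ v : V, |((e v : ℕ) : ℝ) - g (pt c)| < 1 / 2 then h.choose else A 0
  refine ⟨A', ?_⟩
  have hsub : {x | A x ≠ A' (cell N hN x)} ⊆ {x | 1 / 4 ≤ ‖f x - g x‖} := by
    intro x hx
    by_contra hcon
    simp only [mem_ofPred_eq, not_le, Real.norm_eq_abs] at hcon
    have h1 : dist x (pt (cell N hN x)) < τ := by
      rw [Subtype.dist_eq, Real.dist_eq]
      exact (cell_dist N hN x).trans_lt hNτ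
    have h2 := hgτ h1
    rw [Real.dist_eq] at h2
    have h3 : |((e (A x) : ℕ) : ℝ) - g (pt (cell N hN x))| < 1 / 2 := by
      have : ((e (A x) : ℕ) : ℝ) - g (pt (cell N hN x))
        = (f x - g x) + (g x - g (pt (cell N hN x))) := by simp only [f]; ring
      rw [this]
      exact (abs_add_le _ _).trans_lt (by linarith)
    have hex : ∃ v : V, |((e v : ℕ) : ℝ) - g (pt (cell N hN x))| < 1 / 2 := ⟨A x, h3⟩
    apply hx
    have h4 : A' (cell N hN x) = hex.choose := by simp only [A']; rw [dif_pos hex]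
    have h5 := hex.choose_spec
    rw [← h4] at h5
    have h6 : |((e (A x) : ℕ) : ℝ) - ((e (A' (cell N hN x)) : ℕ) : ℝ)| < 1 := by
      rw [abs_lt] at h3 h5 ⊢
      constructor <;> linarith [h3.1, h3.2, h5.1, h5.2]
    have h7 : (e (A x) : ℕ) = (e (A' (cell N hN x)) : ℕ) := by
      rw [abs_lt] at h6
      have a1 : ((e (A x) : ℕ) : ℝ) < ((e (A' (cell N hN x)) : ℕ) : ℝ) + 1 := by linarith [h6.2]
      have a2 : ((e (A' (cell N hN x)) : ℕ) : ℝ) < ((e (A x) : ℕ) : ℝ) + 1 := by linarith [h6.1]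
      have b1 : (e (A x) : ℕ) < (e (A' (cell N hN x)) : ℕ) + 1 := by exact_mod_cast a1
      have b2 : (e (A' (cell N hN x)) : ℕ) < (e (A x) : ℕ) + 1 := by exact_mod_cast a2
      omega
    exact e.injective (Fin.ext h7)
  have hM := mul_meas_ge_le_integral_of_nonneg (μ := (volume : Measure unitInterval))
    (f := fun x => ‖f x - g x‖)
    (Filter.Eventually.of_forall fun x => norm_nonneg _) (hfi.sub hgi).norm (1 / 4)
  have hmono := measureReal_mono (μ := (volume : Measure unitInterval)) hsub
  linarith

theorem exists_matching {V : Type*} [Fintype V] [MeasurableSpace V] [MeasurableSingletonClass V]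
    (A B : unitInterval → V) (hA : Measurable A) (hB : Measurable B) (δ η : ℝ) (hδ : 0 ≤ δ)
    (hη : 0 < η)
    (h : ∀ v, (volume : Measure unitInterval).real {x | A x = v}
      ≤ (volume : Measure unitInterval).real {x | B x = v} + δ) :
    ∃ φ : unitInterval ≃ᵐ unitInterval, MeasurePreserving φ (volume : Measure unitInterval) volume ∧
      (volume : Measure unitInterval).real {x | A x ≠ B (φ x)} ≤ Fintype.card V * δ + η := by
  classical
  set μ : Measure unitInterval := volume with hμ
  set τ : ℝ := η / (2 * Fintype.card V + 2) with hτ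
  have hτ0 : 0 < τ := by positivity
  obtain ⟨N1, hN1⟩ := step_approx A hA τ hτ0
  obtain ⟨N2, hN2⟩ := step_approx B hB τ hτ0
  set N := max (max N1 N2) 1
  have hN : 0 < N := lt_of_lt_of_le one_pos (le_max_right _ _)
  have hN' : (0 : ℝ) < N := by exact_mod_cast hN
  obtain ⟨A', hA'⟩ := hN1 N ((le_max_left _ _).trans (le_max_left _ _)) hN
  obtain ⟨B', hB'⟩ := hN2 N ((le_max_right _ _).trans (le_max_left _ _)) hN
  obtain ⟨σ, hσ⟩ := finite_matching_count A' B' (N * (δ + 2 * τ)) (by positivity) (fun v => by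
    have e1 := cell_volume_set N hN (fun c => A' c = v)
    have e2 := cell_volume_set N hN (fun c => B' c = v)
    have i1 : μ.real {x | A' (cell N hN x) = v} ≤ μ.real {x | A x = v} + τ := by
      calc _ ≤ μ.real ({x | A x = v} ∪ {x | A x ≠ A' (cell N hN x)}) := by
            refine measureReal_mono fun x hx => ?_
            by_cases hh : A x = A' (cell N hN x)
            · left; exact hh.trans hx
            · right; exact hh
        _ ≤ _ := (measureReal_union_le _ _).trans (by gcongr)
    have i2 : μ.real {x | B x = v} ≤ μ.real {x | B' (cell N hN x) = v} + τ := by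
      calc _ ≤ μ.real ({x | B' (cell N hN x) = v} ∪ {x | B x ≠ B' (cell N hN x)}) := by
            refine measureReal_mono fun x hx => ?_
            by_cases hh : B x = B' (cell N hN x)
            · left; exact hh.symm.trans hx
            · right; exact hh
        _ ≤ _ := (measureReal_union_le _ _).trans (by gcongr)
    rw [e1] at i1
    rw [e2] at i2
    have i3 := h v
    have i4 : ((Finset.univ.filter fun i => A' i = v).card : ℝ) / N
      ≤ ((Finset.univ.filter fun i => B' i = v).card : ℝ) / N + (δ + 2 * τ) := by linarith
    rw [div_add' _ _ _ hN'.ne', div_le_div_iff_of_pos_right hN'] at i4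
    linarith)
  have hmp := iex_measurePreserving N hN σ
  refine ⟨iexEquiv N hN σ, hmp, ?_⟩
  have hae : ∀ᵐ x ∂μ, cell N hN (iexEquiv N hN σ x) = σ (cell N hN x) := by
    filter_upwards [ae_lt_one] with x hx using (iex_spec N hN σ x hx).2
  have hBB : μ.real {x | B (iexEquiv N hN σ x) ≠ B' (cell N hN (iexEquiv N hN σ x))} ≤ τ := by
    have hms : MeasurableSet {x | B x ≠ B' (cell N hN x)} := by
      have h1 : Measurable fun x => (B x, B' (cell N hN x)) :=
        hB.prodMk ((measurable_of_finite B').comp (cell_measurable N hN))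
      exact h1 (MeasurableSet.of_discrete (s := {p : V × V | p.1 ≠ p.2}))
    have := hmp.measureReal_preimage hms.nullMeasurableSet
    rw [← this] at hB'
    exact hB'
  have hAB : μ.real {x | A' (cell N hN x) ≠ B' (σ (cell N hN x))}
      ≤ Fintype.card V * (δ + 2 * τ) := by
    have := cell_volume_set N hN (fun c => A' c ≠ B' (σ c))
    rw [this, div_le_iff₀ hN']
    linarith
  have hbad : μ.real {x | ¬ cell N hN (iexEquiv N hN σ x) = σ (cell N hN x)} = 0 := by
    rw [measureReal_def, ae_iff.1 hae]; rfl
  have hfin : μ.real {x | A x ≠ B (iexEquiv N hN σ x)} ≤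
      μ.real ((({x | A x ≠ A' (cell N hN x)} ∪ {x | A' (cell N hN x) ≠ B' (σ (cell N hN x))}) ∪
        {x | B (iexEquiv N hN σ x) ≠ B' (cell N hN (iexEquiv N hN σ x))}) ∪
        {x | ¬ cell N hN (iexEquiv N hN σ x) = σ (cell N hN x)}) := by
    refine measureReal_mono fun x hx => ?_
    by_contra hcon
    simp only [mem_union, mem_ofPred_eq, not_or, not_not] at hcon
    obtain ⟨⟨⟨c1, c2⟩, c3⟩, c4⟩ := hcon
    apply hx
    rw [c1, c2, c3, c4]
  have u1 := measureReal_union_le (μ := μ) (({x | A x ≠ A' (cell N hN x)} ∪ {x | A' (cell N hN x) ≠ B' (σ (cell N hN x))}) ∪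
        {x | B (iexEquiv N hN σ x) ≠ B' (cell N hN (iexEquiv N hN σ x))})
        {x | ¬ cell N hN (iexEquiv N hN σ x) = σ (cell N hN x)}
  have u2 := measureReal_union_le (μ := μ) ({x | A x ≠ A' (cell N hN x)} ∪ {x | A' (cell N hN x) ≠ B' (σ (cell N hN x))})
        {x | B (iexEquiv N hN σ x) ≠ B' (cell N hN (iexEquiv N hN σ x))}
  have u3 := measureReal_union_le (μ := μ) {x | A x ≠ A' (cell N hN x)} {x | A' (cell N hN x) ≠ B' (σ (cell N hN x))}
  have e3 : (2 * Fintype.card V + 2) * τ = η := by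
    rw [hτ]; field_simp
  nlinarith



/-- admissible families of test functions -/
def Admis (F : ℕ → unitInterval → ℝ) : Prop :=
  ∀ i, Measurable (F i) ∧ ∀ x, F i x ∈ Icc (-1 : ℝ) 1

/-- the product probability measure on `[0,1] × [0,1] × Ω₂` -/
abbrev nuM {Ω₂ : Type*} [MeasurableSpace Ω₂] (P₂ : Measure Ω₂) :
    Measure (unitInterval × unitInterval × Ω₂) :=
  (volume : Measure unitInterval).prod ((volume : Measure unitInterval).prod P₂)

theorem sVec_measurable {Ω₂ : Type*} [MeasurableSpace Ω₂] {k : ℕ}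
    (f : Fin k → unitInterval → ℝ) (hf : ∀ i, Measurable (f i))
    (W : unitInterval × unitInterval × Ω₂ → ℝ) (hW : Measurable W) : Measurable (sVec k f W) := by
  unfold sVec
  refine (WithLp.measurable_toLp 2 (Fin (2 * k + 1) → ℝ)).comp (measurable_pi_lambda _ fun i => ?_)
  by_cases h : (i : ℕ) < 2 * k
  · by_cases h2 : (i : ℕ) % 2 = 0
    · simp only [h, h2, dite_true, if_true]
      exact (hf _).comp measurable_fst
    · simp only [h, h2, dite_true, if_false]
      exact (hf _).comp (measurable_fst.comp measurable_snd)
  · simp only [h, dite_false]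
    exact hW

theorem Smeasure_prob {Ω₂ : Type*} [MeasurableSpace Ω₂] (P₂ : Measure Ω₂) [IsProbabilityMeasure P₂]
    {k : ℕ} (f : Fin k → unitInterval → ℝ) (hf : ∀ i, Measurable (f i))
    (W : unitInterval × unitInterval × Ω₂ → ℝ) (hW : Measurable W) :
    IsProbabilityMeasure (Smeasure (volume : Measure unitInterval) P₂ f W) :=
  Measure.isProbabilityMeasure_map (sVec_measurable f hf W hW).aemeasurable

theorem eHausLP_le_one {X : Type*} [MeasurableSpace X] [PseudoEMetricSpace X]
    (A B : Set (Measure X)) (hA : A.Nonempty) (hB : B.Nonempty)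
    (hA1 : ∀ μ ∈ A, IsProbabilityMeasure μ) (hB1 : ∀ μ ∈ B, IsProbabilityMeasure μ) :
    eHausLP A B ≤ 1 := by
  have key : ∀ μ ∈ A, ∀ ν ∈ B, levyProkhorovEDist μ ν ≤ 1 := by
    intro μ hμ ν hν
    have := hA1 μ hμ
    have := hB1 ν hν
    simpa using levyProkhorovEDist_le_max_measure_univ μ ν
  obtain ⟨μ0, h0⟩ := hA
  obtain ⟨ν0, h1⟩ := hB
  refine max_le (iSup₂_le fun μ hμ => ?_) (iSup₂_le fun ν hν => ?_)
  · exact (iInf₂_le ν0 h1).trans (key μ hμ ν0 h1)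
  · exact (iInf₂_le μ0 h0).trans (key μ0 h0 ν hν)

theorem SkSet_prob {Ω₂ : Type*} [MeasurableSpace Ω₂] (P₂ : Measure Ω₂) [IsProbabilityMeasure P₂]
    (k : ℕ) (W : unitInterval × unitInterval × Ω₂ → ℝ) (hW : Measurable W) :
    ∀ μ ∈ SkSet (volume : Measure unitInterval) P₂ k W, IsProbabilityMeasure μ := by
  rintro _ ⟨f, hf, -, rfl⟩
  exact Smeasure_prob P₂ f hf W hW

theorem SkSet_nonempty {Ω₂ : Type*} [MeasurableSpace Ω₂] (P₂ : Measure Ω₂)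
    (k : ℕ) (W : unitInterval × unitInterval × Ω₂ → ℝ) :
    (SkSet (volume : Measure unitInterval) P₂ k W).Nonempty :=
  ⟨_, fun _ _ => 0, fun _ => measurable_const, fun _ _ => by simp, rfl⟩

theorem profile_close {Ω₂ : Type*} [MeasurableSpace Ω₂] (P₂ : Measure Ω₂) [IsProbabilityMeasure P₂]
    (W : ℕ → unitInterval × unitInterval × Ω₂ → ℝ) (hW : ∀ n, Measurable (W n))
    (hcauchy : ∀ ε > (0 : ℝ), ∃ N : ℕ, ∀ m ≥ N, ∀ n ≥ N,
      dM (PVar.ofUnitInterval P₂ (W m) (hW m))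
         (PVar.ofUnitInterval P₂ (W n) (hW n)) < ε) (k : ℕ) (δ : ℝ) (hδ : 0 < δ) :
    ∃ N : ℕ, ∀ m ≥ N, ∀ n ≥ N, ∀ F, Admis F → ∃ G, Admis G ∧
      levyProkhorovEDist
        (Smeasure (volume : Measure unitInterval) P₂ (fun i : Fin (k + 1) => F i) (W m))
        (Smeasure (volume : Measure unitInterval) P₂ (fun i : Fin (k + 1) => G i) (W n))
        < ENNReal.ofReal δ := by
  obtain ⟨N, hN⟩ := hcauchy ((2 : ℝ)⁻¹ ^ (k + 1) * δ) (by positivity)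
  refine ⟨N, fun m hm n hn F hF => ?_⟩
  have h1 := hN m hm n hn
  unfold dM at h1
  have hle : ∀ j, eHausLP ((PVar.ofUnitInterval P₂ (W m) (hW m)).Sk (j + 1))
      ((PVar.ofUnitInterval P₂ (W n) (hW n)).Sk (j + 1)) ≤ 1 := fun j =>
    eHausLP_le_one (SkSet (volume : Measure unitInterval) P₂ (j + 1) (W m))
      (SkSet (volume : Measure unitInterval) P₂ (j + 1) (W n))
      (SkSet_nonempty P₂ _ _) (SkSet_nonempty P₂ _ _)
      (SkSet_prob P₂ _ _ (hW m)) (SkSet_prob P₂ _ _ (hW n))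
  have hle' : ∀ j, dHLP ((PVar.ofUnitInterval P₂ (W m) (hW m)).Sk (j + 1))
      ((PVar.ofUnitInterval P₂ (W n) (hW n)).Sk (j + 1)) ≤ 1 := fun j => by
    unfold dHLP
    simpa using ENNReal.toReal_mono ENNReal.one_ne_top (hle j)
  have hs : Summable fun j : ℕ => (2 : ℝ)⁻¹ ^ (j + 1) *
      dHLP ((PVar.ofUnitInterval P₂ (W m) (hW m)).Sk (j + 1))
      ((PVar.ofUnitInterval P₂ (W n) (hW n)).Sk (j + 1)) := by
    have hg : Summable fun j : ℕ => (2 : ℝ)⁻¹ ^ (j + 1) :=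
      (summable_nat_add_iff 1).2 (summable_geometric_of_lt_one (by norm_num) (by norm_num))
    refine Summable.of_nonneg_of_le (fun j => ?_) (fun j => ?_) hg
    · exact mul_nonneg (by positivity) ENNReal.toReal_nonneg
    · exact mul_le_of_le_one_right (by positivity) (hle' j)
  have h2 := hs.le_tsum k (fun j _ => mul_nonneg (by positivity) ENNReal.toReal_nonneg)
  have h3 : dHLP ((PVar.ofUnitInterval P₂ (W m) (hW m)).Sk (k + 1))
      ((PVar.ofUnitInterval P₂ (W n) (hW n)).Sk (k + 1)) < δ :=
    lt_of_mul_lt_mul_left (h2.trans_lt h1) (by positivity)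
  unfold dHLP at h3
  have h4 := (ENNReal.lt_ofReal_iff_toReal_lt ((hle k).trans_lt ENNReal.one_lt_top).ne).2 h3
  have h5 : (⨅ ν ∈ SkSet (volume : Measure unitInterval) P₂ (k + 1) (W n), levyProkhorovEDist
      (Smeasure (volume : Measure unitInterval) P₂ (fun i : Fin (k + 1) => F i) (W m)) ν)
      < ENNReal.ofReal δ := by
    refine lt_of_le_of_lt ?_ ((le_max_left _ _).trans_lt h4)
    refine le_iSup₂ (f := fun μ (_ : μ ∈ SkSet (volume : Measure unitInterval) P₂ (k + 1) (W m)) =>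
      ⨅ ν ∈ SkSet (volume : Measure unitInterval) P₂ (k + 1) (W n), levyProkhorovEDist μ ν)
      (Smeasure (volume : Measure unitInterval) P₂ (fun i : Fin (k + 1) => F i) (W m)) ?_
    exact ⟨_, fun i => (hF i).1, fun i => (hF i).2, rfl⟩
  simp only [iInf_lt_iff] at h5
  obtain ⟨_, ⟨g, hg1, hg2, rfl⟩, hlt⟩ := h5
  refine ⟨fun i => if h : i < k + 1 then g ⟨i, h⟩ else fun _ => 0, fun i => ?_, ?_⟩
  · by_cases h : i < k + 1
    · simp only [h, dite_true]; exact ⟨hg1 _, hg2 _⟩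
    · simp only [h, dite_false]; exact ⟨measurable_const, fun _ => by simp⟩
  · have e : (fun i : Fin (k + 1) => (if h : (i : ℕ) < k + 1 then g ⟨i, h⟩ else fun _ => 0)) = g := by
      ext i x
      rw [dif_pos i.2]
    rw [e]; exact hlt

theorem test_lemma (n : ℕ) (M : ℝ) (hM : -M ≤ M) (q : (Fin n → Icc (-M) M) → ℝ) (hq : Continuous q)
    (η : ℝ) (hη : 0 < η) : ∃ δ > 0, ∀ δ' > 0, δ' ≤ δ → ∀ μ ν : Measure (RE n),
      IsProbabilityMeasure μ → IsProbabilityMeasure ν →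
      levyProkhorovEDist μ ν < ENNReal.ofReal δ' →
      ∫ v, q (fun i => projIcc (-M) M hM (v i)) ∂μ
        ≤ ∫ v, q (fun i => projIcc (-M) M hM (v i)) ∂ν + η := by
  have hqu : UniformContinuous q := CompactSpace.uniformContinuous_of_continuous hq
  have hpi : UniformContinuous fun (v : RE n) (i : Fin n) => projIcc (-M) M hM (v i) := by
    rw [uniformContinuous_pi]
    intro i
    refine (LipschitzWith.projIcc hM).uniformContinuous.comp ?_
    have : LipschitzWith 1 fun v : RE n => v i := by
      refine LipschitzWith.of_dist_le_mul fun x y => ?_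
      simp only [NNReal.coe_one, one_mul]
      rw [dist_eq_norm, dist_eq_norm]
      exact PiLp.norm_apply_le (x - y) i
    exact this.uniformContinuous
  have hu := hqu.comp hpi
  obtain ⟨δ0, hδ0, h0⟩ := Metric.uniformContinuous_iff.1 hu (η / 2) (by linarith)
  have hne : Nonempty (Icc (-M) M) := ⟨⟨M, hM, le_rfl⟩⟩
  obtain ⟨u0, -, hu0⟩ := isCompact_univ.exists_isMaxOn (univ_nonempty)
    (hq.abs.continuousOn (s := (univ : Set (Fin n → Icc (-M) M))))
  set B := |q u0|
  have hB : ∀ u, |q u| ≤ B := fun u => hu0 (mem_univ u)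
  refine ⟨min δ0 (η / (4 * (B + 1))), lt_min hδ0 (by positivity), fun δ' h1 h2 μ ν hμ hν hlt => ?_⟩
  have key := lp_integral μ ν (η := η / 2) (B := B) h1 (by linarith) hlt
    (fun v => q (fun i => projIcc (-M) M hM (v i))) hu.continuous (fun v => hB _)
    (fun x y hxy => (h0 (hxy.trans_le (h2.trans (min_le_left _ _)))).le)
  have h3 : δ' * (2 * B) ≤ η / 2 := by
    have h4 : δ' ≤ η / (4 * (B + 1)) := h2.trans (min_le_right _ _)
    have hB0 : 0 ≤ B := abs_nonneg _
    rw [le_div_iff₀ (by positivity)] at h4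
    nlinarith
  linarith



/-- the finite rank kernel built from a family of test functions -/
def hF (a : ℝ) (k : ℕ) (F : ℕ → unitInterval → ℝ) (x y : unitInterval) : ℝ :=
  a * ∑ i ∈ Finset.range k, F (2 * i) x * F (2 * i + 1) y

/-- truncation -/
def clampM (M t : ℝ) : ℝ := max (-M) (min M t)

/-- energy integrand -/
def enI {Ω₂ : Type*} (a M : ℝ) (k : ℕ) (F : ℕ → unitInterval → ℝ)
    (W : unitInterval × unitInterval × Ω₂ → ℝ) (z : unitInterval × unitInterval × Ω₂) : ℝ :=
  2 * clampM M (W z) * hF a k F z.1 z.2.1 - hF a k F z.1 z.2.1 ^ 2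

/-- energy -/
def en {Ω₂ : Type*} [MeasurableSpace Ω₂] (P₂ : Measure Ω₂) (a M : ℝ) (k : ℕ)
    (F : ℕ → unitInterval → ℝ) (W : unitInterval × unitInterval × Ω₂ → ℝ) : ℝ :=
  ∫ z, enI a M k F W z ∂(nuM P₂)

theorem clampM_abs {M : ℝ} (hM : 0 ≤ M) (t : ℝ) : |clampM M t| ≤ M := by
  unfold clampM
  rw [abs_le]
  exact ⟨le_max_left _ _, max_le (by linarith) (min_le_left _ _)⟩

theorem clampM_measurable (M : ℝ) : Measurable (clampM M) := by
  unfold clampM; fun_prop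

theorem prod_diff {s t s' t' τ : ℝ} (ht : |t| ≤ 1) (hs' : |s'| ≤ 1) (h1 : |s - s'| ≤ τ)
    (h2 : |t - t'| ≤ τ) : |s * t - s' * t'| ≤ 2 * τ := by
  have e : s * t - s' * t' = (s - s') * t + s' * (t - t') := by ring
  have hτ : 0 ≤ τ := (abs_nonneg _).trans h1
  rw [e]
  refine (abs_add_le _ _).trans ?_
  rw [abs_mul, abs_mul]
  have a1 : |s - s'| * |t| ≤ τ * 1 := mul_le_mul h1 ht (abs_nonneg _) hτ
  have a2 : |s'| * |t - t'| ≤ 1 * τ := mul_le_mul hs' h2 (abs_nonneg _) zero_le_one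
  linarith

theorem Admis.abs_le_one {F : ℕ → unitInterval → ℝ} (hF : Admis F) (i : ℕ) (x : unitInterval) :
    |F i x| ≤ 1 := abs_le.2 ((hF i).2 x)

theorem hF_diff {a : ℝ} (ha : 0 ≤ a) (k : ℕ) {F G : ℕ → unitInterval → ℝ} (hFA : Admis F)
    (hGA : Admis G) (x y x' y' : unitInterval) (τ : ℝ)
    (hx : ∀ i < 2 * k, |F i x - G i x'| ≤ τ) (hy : ∀ i < 2 * k, |F i y - G i y'| ≤ τ) :
    |hF a k F x y - hF a k G x' y'| ≤ 2 * a * k * τ := by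
  unfold hF
  rw [← mul_sub, ← Finset.sum_sub_distrib, abs_mul, abs_of_nonneg ha]
  have : |∑ i ∈ Finset.range k, (F (2 * i) x * F (2 * i + 1) y - G (2 * i) x' * G (2 * i + 1) y')|
      ≤ ∑ i ∈ Finset.range k, 2 * τ := by
    refine (Finset.abs_sum_le_sum_abs _ _).trans (Finset.sum_le_sum fun i hi => ?_)
    have hi' := Finset.mem_range.1 hi
    exact prod_diff (hFA.abs_le_one _ _) (hGA.abs_le_one _ _) (hx _ (by omega)) (hy _ (by omega))
  rw [Finset.sum_const, Finset.card_range, nsmul_eq_mul] at this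
  nlinarith [mul_le_mul_of_nonneg_left this ha]

theorem hF_abs {a : ℝ} (ha : 0 ≤ a) (k : ℕ) {F : ℕ → unitInterval → ℝ} (hFA : Admis F)
    (x y : unitInterval) : |hF a k F x y| ≤ a * k := by
  unfold hF
  rw [abs_mul, abs_of_nonneg ha]
  gcongr
  calc _ ≤ ∑ i ∈ Finset.range k, |F (2 * i) x * F (2 * i + 1) y| := Finset.abs_sum_le_sum_abs _ _
    _ ≤ ∑ i ∈ Finset.range k, (1 : ℝ) := Finset.sum_le_sum fun i _ => by
        rw [abs_mul]
        exact mul_le_one₀ (hFA.abs_le_one _ _) (abs_nonneg _) (hFA.abs_le_one _ _)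
    _ = k := by simp

theorem hF_measurable (a : ℝ) (k : ℕ) {F : ℕ → unitInterval → ℝ} (hFA : Admis F) :
    Measurable fun p : unitInterval × unitInterval => hF a k F p.1 p.2 := by
  unfold hF
  refine Measurable.const_mul (Finset.measurable_fun_sum _ fun i _ => ?_) _
  exact ((hFA _).1.comp measurable_fst).mul ((hFA _).1.comp measurable_snd)

section
variable {Ω₂ : Type*} [MeasurableSpace Ω₂]

theorem hF_measurable3 (a : ℝ) (k : ℕ) {F : ℕ → unitInterval → ℝ} (hFA : Admis F) :
    Measurable fun z : unitInterval × unitInterval × Ω₂ => hF a k F z.1 z.2.1 :=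
  (hF_measurable a k hFA).comp (measurable_fst.prodMk (measurable_fst.comp measurable_snd))

theorem enI_measurable (a M : ℝ) (k : ℕ) {F : ℕ → unitInterval → ℝ} (hFA : Admis F)
    {W : unitInterval × unitInterval × Ω₂ → ℝ} (hW : Measurable W) :
    Measurable (enI a M k F W) := by
  unfold enI
  have h1 := hF_measurable3 (Ω₂ := Ω₂) a k hFA
  have h2 := (clampM_measurable M).comp hW
  exact ((h2.const_mul 2).mul h1).sub (h1.pow_const 2)

theorem enI_integrable (P₂ : Measure Ω₂) [IsProbabilityMeasure P₂] {a M : ℝ} (ha : 0 ≤ a)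
    (hM : 0 ≤ M) (k : ℕ) {F : ℕ → unitInterval → ℝ} (hFA : Admis F)
    {W : unitInterval × unitInterval × Ω₂ → ℝ} (hW : Measurable W) :
    Integrable (enI a M k F W) (nuM P₂) := by
  refine Integrable.of_bound (enI_measurable a M k hFA hW).aestronglyMeasurable
    (2 * M * (a * k) + (a * k) ^ 2) (Filter.Eventually.of_forall fun z => ?_)
  unfold enI
  have h1 := hF_abs ha k hFA z.1 z.2.1
  have h2 := clampM_abs hM (W z)
  rw [Real.norm_eq_abs]
  refine (abs_sub _ _).trans ?_
  rw [abs_mul, abs_mul, abs_pow, abs_two]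
  gcongr

theorem en_le (P₂ : Measure Ω₂) [IsProbabilityMeasure P₂] {a M : ℝ} (ha : 0 ≤ a)
    (hM : 0 ≤ M) (k : ℕ) {F : ℕ → unitInterval → ℝ} (hFA : Admis F)
    {W : unitInterval × unitInterval × Ω₂ → ℝ} (hW : Measurable W) :
    en P₂ a M k F W ≤ M ^ 2 := by
  unfold en
  calc _ ≤ ∫ z, M ^ 2 ∂(nuM P₂) := by
        refine integral_mono (enI_integrable P₂ ha hM k hFA hW) (integrable_const _) fun z => ?_
        have h2 := sq_le_sq' (abs_le.1 (clampM_abs hM (W z))).1 (abs_le.1 (clampM_abs hM (W z))).2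
        simp only [enI]
        nlinarith [sq_nonneg (clampM M (W z) - hF a k F z.1 z.2.1)]
    _ = M ^ 2 := by simp

theorem en_perturb (P₂ : Measure Ω₂) [IsProbabilityMeasure P₂] {a M : ℝ} (ha : 0 ≤ a)
    (hM : 0 ≤ M) (k : ℕ) {F G : ℕ → unitInterval → ℝ} (hFA : Admis F) (hGA : Admis G)
    {W : unitInterval × unitInterval × Ω₂ → ℝ} (hW : Measurable W) (τ : ℝ)
    (h : ∀ i x, |F i x - G i x| ≤ τ) :
    en P₂ a M k F W ≤ en P₂ a M k G W + (2 * M + 2 * (a * k)) * (2 * a * k * τ) := by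
  unfold en
  have e : ∫ z, enI a M k G W z ∂(nuM P₂) + (2 * M + 2 * (a * k)) * (2 * a * k * τ)
      = ∫ z, (enI a M k G W z + (2 * M + 2 * (a * k)) * (2 * a * k * τ)) ∂(nuM P₂) := by
    rw [integral_add (enI_integrable P₂ ha hM k hGA hW) (integrable_const _)]; simp
  rw [e]
  refine integral_mono (enI_integrable P₂ ha hM k hFA hW)
    ((enI_integrable P₂ ha hM k hGA hW).add (integrable_const _)) fun z => ?_
  simp only [enI]
  have h1 := hF_diff ha k hFA hGA z.1 z.2.1 z.1 z.2.1 τ (fun i _ => h i _) (fun i _ => h i _)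
  have h2 := hF_abs ha k hFA z.1 z.2.1
  have h3 := hF_abs ha k hGA z.1 z.2.1
  have h4 := clampM_abs hM (W z)
  set s := hF a k F z.1 z.2.1
  set t := hF a k G z.1 z.2.1
  set c := clampM M (W z)
  have h5 : |2 * c - s - t| ≤ 2 * M + 2 * (a * k) := by
    rw [abs_le] at h2 h3 h4 ⊢
    constructor <;> linarith [h2.1, h2.2, h3.1, h3.2, h4.1, h4.2]
  have h6 : (2 * c - s - t) * (s - t) ≤ (2 * M + 2 * (a * k)) * (2 * a * k * τ) := by
    refine (le_abs_self _).trans ?_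
    rw [abs_mul]
    exact mul_le_mul h5 h1 (abs_nonneg _) ((abs_nonneg _).trans h5)
  linarith [h6, (by ring : (2 * c - s - t) * (s - t) = 2 * c * s - s ^ 2 - (2 * c * t - t ^ 2))]

/-- the correlation of the residual with a rectangle -/
def resid (P₂ : Measure Ω₂) (a M : ℝ) (k : ℕ) (F : ℕ → unitInterval → ℝ)
    (W : unitInterval × unitInterval × Ω₂ → ℝ) (S T : Set unitInterval) : ℝ :=
  ∫ z, (clampM M (W z) - hF a k F z.1 z.2.1) *
    (S.indicator (fun _ => (1 : ℝ)) z.1 * T.indicator (fun _ => (1 : ℝ)) z.2.1) ∂(nuM P₂)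

theorem en_step (P₂ : Measure Ω₂) [IsProbabilityMeasure P₂] {a M : ℝ} (ha : 0 ≤ a)
    (hM : 0 ≤ M) (k : ℕ) {F : ℕ → unitInterval → ℝ} (hFA : Admis F)
    {W : unitInterval × unitInterval × Ω₂ → ℝ} (hW : Measurable W) {S T : Set unitInterval}
    (hS : MeasurableSet S) (hT : MeasurableSet T) (s : ℝ) (hs : s = 1 ∨ s = -1) :
    ∃ F', Admis F' ∧
      en P₂ a M k F W + 2 * a * (s * resid P₂ a M k F W S T) - a ^ 2 ≤ en P₂ a M (k + 1) F' W := by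
  classical
  set F' : ℕ → unitInterval → ℝ := fun i => if i = 2 * k then
    fun x => s * S.indicator (fun _ => (1 : ℝ)) x else if i = 2 * k + 1 then
    T.indicator (fun _ => (1 : ℝ)) else F i with hF'
  have hiS : Measurable (S.indicator fun _ => (1 : ℝ)) := measurable_const.indicator hS
  have hiT : Measurable (T.indicator fun _ => (1 : ℝ)) := measurable_const.indicator hT
  have iS : ∀ x, S.indicator (fun _ => (1 : ℝ)) x = 0 ∨ S.indicator (fun _ => (1 : ℝ)) x = 1 :=
    fun x => by by_cases h : x ∈ S <;> simp [h]
  have iT : ∀ x, T.indicator (fun _ => (1 : ℝ)) x = 0 ∨ T.indicator (fun _ => (1 : ℝ)) x = 1 :=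
    fun x => by by_cases h : x ∈ T <;> simp [h]
  have hA' : Admis F' := by
    intro i
    by_cases h1 : i = 2 * k
    · simp only [hF', h1, if_true]
      refine ⟨hiS.const_mul _, fun x => ?_⟩
      rcases iS x with h | h <;> rcases hs with h' | h' <;> simp [h, h']
    · by_cases h2 : i = 2 * k + 1
      · simp only [hF', h1, if_false, h2, if_true]
        refine ⟨by simpa using hiT, fun x => ?_⟩
        rcases iT x with h | h <;> simp [h]
      · simp only [hF', h1, if_false, h2]
        exact hFA i
  refine ⟨F', hA', ?_⟩
  have hh : ∀ x y, hF a (k + 1) F' x y = hF a k F x y +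
      a * (s * (S.indicator (fun _ => (1 : ℝ)) x * T.indicator (fun _ => (1 : ℝ)) y)) := by
    intro x y
    unfold hF
    rw [Finset.sum_range_succ, mul_add]
    congr 1
    · congr 1
      refine Finset.sum_congr rfl fun i hi => ?_
      have hi' := Finset.mem_range.1 hi
      have e1 : F' (2 * i) = F (2 * i) := by
        simp only [hF']; rw [if_neg (by omega), if_neg (by omega)]
      have e2 : F' (2 * i + 1) = F (2 * i + 1) := by
        simp only [hF']; rw [if_neg (by omega), if_neg (by omega)]
      rw [e1, e2]
    · simp [hF', mul_assoc]
  have hri : Integrable (fun z : unitInterval × unitInterval × Ω₂ =>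
      (clampM M (W z) - hF a k F z.1 z.2.1) *
      (S.indicator (fun _ => (1 : ℝ)) z.1 * T.indicator (fun _ => (1 : ℝ)) z.2.1)) (nuM P₂) := by
    refine Integrable.of_bound (C := M + a * k) ?_ (Filter.Eventually.of_forall fun z => ?_)
    · refine Measurable.aestronglyMeasurable ?_
      exact (((clampM_measurable M).comp hW).sub (hF_measurable3 a k hFA)).mul
        ((hiS.comp measurable_fst).mul (hiT.comp (measurable_fst.comp measurable_snd)))
    · have h1 := hF_abs ha k hFA z.1 z.2.1
      have h2 := clampM_abs hM (W z)
      have h3 : |clampM M (W z) - hF a k F z.1 z.2.1| ≤ M + a * k :=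
        (abs_sub _ _).trans (by linarith)
      have h4 : 0 ≤ M + a * k := (abs_nonneg _).trans h3
      rw [Real.norm_eq_abs, abs_mul]
      rcases iS z.1 with h | h <;> rcases iT z.2.1 with h' | h' <;> simp [h, h', h3, h4]
  have e : en P₂ a M k F W + 2 * a * (s * resid P₂ a M k F W S T) - a ^ 2
      = ∫ z, (enI a M k F W z + 2 * a * (s * ((clampM M (W z) - hF a k F z.1 z.2.1) *
    (S.indicator (fun _ => (1 : ℝ)) z.1 * T.indicator (fun _ => (1 : ℝ)) z.2.1))) - a ^ 2)
      ∂(nuM P₂) := by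
    unfold en resid
    have hadd : Integrable (fun z => enI a M k F W z + 2 * a * (s * ((clampM M (W z) -
      hF a k F z.1 z.2.1) * (S.indicator (fun _ => (1 : ℝ)) z.1 *
      T.indicator (fun _ => (1 : ℝ)) z.2.1)))) (nuM P₂) :=
      (enI_integrable P₂ ha hM k hFA hW).add ((hri.const_mul s).const_mul (2 * a))
    rw [integral_sub hadd (integrable_const _), integral_add (enI_integrable P₂ ha hM k hFA hW)
      ((hri.const_mul s).const_mul (2 * a)), integral_const_mul, integral_const_mul]
    simp
  rw [e]
  unfold en
  refine integral_mono (((enI_integrable P₂ ha hM k hFA hW).add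
    ((hri.const_mul s).const_mul (2 * a))).sub (integrable_const _))
    (enI_integrable P₂ ha hM (k + 1) hA' hW) fun z => ?_
  simp only [enI, hh]
  have hss : s ^ 2 = 1 := by rcases hs with h | h <;> rw [h] <;> norm_num
  rcases iS z.1 with h | h <;> rcases iT z.2.1 with h' | h' <;> rw [h, h'] <;>
    nlinarith [sq_nonneg a]

theorem resid_bound (P₂ : Measure Ω₂) [IsProbabilityMeasure P₂] {a M : ℝ} (ha : 0 < a)
    (hM : 0 ≤ M) (k : ℕ) {F : ℕ → unitInterval → ℝ} (hFA : Admis F)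
    {W : unitInterval × unitInterval × Ω₂ → ℝ} (hW : Measurable W) {S T : Set unitInterval}
    (hS : MeasurableSet S) (hT : MeasurableSet T) (R : ℝ)
    (h1 : ∀ F', Admis F' → en P₂ a M (k + 1) F' W ≤ R) (h2 : R - a ^ 2 ≤ en P₂ a M k F W) :
    |resid P₂ a M k F W S T| ≤ a := by
  rw [abs_le']
  constructor
  · obtain ⟨F', hA', h⟩ := en_step P₂ ha.le hM k hFA hW hS hT 1 (Or.inl rfl)
    have := h1 F' hA'
    have : a * resid P₂ a M k F W S T ≤ a * a := by nlinarith
    exact le_of_mul_le_mul_left this ha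
  · obtain ⟨F', hA', h⟩ := en_step P₂ ha.le hM k hFA hW hS hT (-1) (Or.inr rfl)
    have := h1 F' hA'
    have : a * (-resid P₂ a M k F W S T) ≤ a * a := by nlinarith
    exact le_of_mul_le_mul_left this ha

theorem sVec_even {k : ℕ} (f : Fin k → unitInterval → ℝ)
    (W : unitInterval × unitInterval × Ω₂ → ℝ) (z : unitInterval × unitInterval × Ω₂)
    (i : ℕ) (hi : i < k) : sVec k f W z ⟨2 * i, by omega⟩ = f ⟨i, hi⟩ z.1 := by
  unfold sVec
  have h : 2 * i < 2 * k := by omega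
  have h2 : 2 * i / 2 = i := by omega
  simp [hi]

theorem sVec_odd {k : ℕ} (f : Fin k → unitInterval → ℝ)
    (W : unitInterval × unitInterval × Ω₂ → ℝ) (z : unitInterval × unitInterval × Ω₂)
    (i : ℕ) (hi : i < k) : sVec k f W z ⟨2 * i + 1, by omega⟩ = f ⟨i, hi⟩ z.2.1 := by
  unfold sVec
  have h : 2 * i + 1 < 2 * k := by omega
  have h2 : (2 * i + 1) / 2 = i := by omega
  have h3 : ¬ ((2 * i + 1) % 2 = 0) := by omega
  simp [h, h2]

theorem sVec_last {k : ℕ} (f : Fin k → unitInterval → ℝ)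
    (W : unitInterval × unitInterval × Ω₂ → ℝ) (z : unitInterval × unitInterval × Ω₂) :
    sVec k f W z ⟨2 * k, by omega⟩ = W z := by
  unfold sVec
  simp

theorem en_close (P₂ : Measure Ω₂) [IsProbabilityMeasure P₂] {a M : ℝ}
    (hM : 1 ≤ M) (k : ℕ) (η : ℝ) (hη : 0 < η) :
    ∃ δ > 0, ∀ δ' > 0, δ' ≤ δ → ∀ W U : unitInterval × unitInterval × Ω₂ → ℝ,
      Measurable W → Measurable U → ∀ F G, Admis F → Admis G →
      levyProkhorovEDist
        (Smeasure (volume : Measure unitInterval) P₂ (fun i : Fin (2 * k + 1) => F i) W)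
        (Smeasure (volume : Measure unitInterval) P₂ (fun i : Fin (2 * k + 1) => G i) U)
        < ENNReal.ofReal δ' → en P₂ a M k F W ≤ en P₂ a M k G U + η := by
  have hMM : -M ≤ M := by linarith
  let H : (Fin (2 * (2 * k + 1) + 1) → Icc (-M) M) → ℝ := fun u =>
    a * ∑ i : Fin k, (u ⟨2 * (2 * (i : ℕ)), by omega⟩ : ℝ) *
      (u ⟨2 * (2 * (i : ℕ) + 1) + 1, by omega⟩ : ℝ)
  let q : (Fin (2 * (2 * k + 1) + 1) → Icc (-M) M) → ℝ := fun u =>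
    2 * (u ⟨2 * (2 * k + 1), by omega⟩ : ℝ) * H u - H u ^ 2
  have hH : Continuous H := by
    refine continuous_const.mul (continuous_finsetSum _ fun i _ => ?_)
    exact (continuous_subtype_val.comp (continuous_apply _)).mul
      (continuous_subtype_val.comp (continuous_apply _))
  have hq : Continuous q := by
    refine ((continuous_const.mul (continuous_subtype_val.comp (continuous_apply _))).mul hH).sub
      (hH.pow 2)
  obtain ⟨δ, hδ, h⟩ := test_lemma _ M hMM q hq η hη
  refine ⟨δ, hδ, fun δ' h1 h2 W U hW hU F G hFA hGA hlt => ?_⟩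
  have hen : ∀ (F : ℕ → unitInterval → ℝ) (W : unitInterval × unitInterval × Ω₂ → ℝ), Admis F →
      Measurable W → en P₂ a M k F W = ∫ v, q (fun i => projIcc (-M) M hMM (v i))
      ∂(Smeasure (volume : Measure unitInterval) P₂ (fun i : Fin (2 * k + 1) => F i) W) := by
    intro F W hFA hW
    have hpc : Continuous fun (v : RE (2 * (2 * k + 1) + 1)) =>
        q (fun i => projIcc (-M) M hMM (v i)) := by
      have hg : Continuous fun (v : RE (2 * (2 * k + 1) + 1)) =>
          (fun i => projIcc (-M) M hMM (v i)) := by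
        refine continuous_pi fun i => ?_
        have hi : Continuous fun v : RE (2 * (2 * k + 1) + 1) => v i := by fun_prop
        exact (continuous_projIcc (h := hMM)).comp hi
      exact hq.comp hg
    unfold Smeasure
    rw [integral_map (sVec_measurable _ (fun i => (hFA i).1) W hW).aemeasurable
      hpc.aestronglyMeasurable]
    unfold en
    refine integral_congr_ae (Filter.Eventually.of_forall fun z => ?_)
    have hcl : ∀ i x, max (-M) (min M (F i x)) = F i x := by
      intro i x
      have := (hFA i).2 x
      rw [min_eq_right (by linarith [this.2]), max_eq_right (by linarith [this.1])]
    have hHz : H (fun i => projIcc (-M) M hMM (sVec (2 * k + 1) (fun i : Fin (2 * k + 1) => F i) W z i))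
        = hF a k F z.1 z.2.1 := by
      simp only [H, hF]
      rw [Finset.sum_range]
      congr 1
      refine Finset.sum_congr rfl fun i _ => ?_
      rw [sVec_even _ W z (2 * (i : ℕ)) (by omega), sVec_odd _ W z (2 * (i : ℕ) + 1) (by omega),
        coe_projIcc, coe_projIcc, hcl, hcl]
    simp only [q, enI, hHz]
    rw [sVec_last, coe_projIcc]
    rfl
  rw [hen F W hFA hW, hen G U hGA hU]
  exact h δ' h1 h2 _ _ (Smeasure_prob P₂ _ (fun i => (hFA i).1) W hW)
    (Smeasure_prob P₂ _ (fun i => (hGA i).1) U hU) hlt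

end



/-- grid index of a real number -/
def gidx (r : ℕ) (t : ℝ) : ℕ := min ⌊(t + 1) * r + 1 / 2⌋₊ (2 * r)

/-- grid value -/
def gval (r : ℕ) (j : ℕ) : ℝ := (j : ℝ) / r - 1

theorem gidx_le (r : ℕ) (t : ℝ) : gidx r t ≤ 2 * r := min_le_right _ _

theorem gidx_measurable (r : ℕ) : Measurable (gidx r) := by
  unfold gidx
  exact (Nat.measurable_floor.comp ((measurable_id.add_const 1).mul_const _ |>.add_const _)).min
    measurable_const

theorem gval_gidx {r : ℕ} (hr : 0 < r) {t : ℝ} (ht : t ∈ Icc (-1 : ℝ) 1) :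
    |t - gval r (gidx r t)| ≤ 1 / r := by
  have hr' : (0 : ℝ) < r := by exact_mod_cast hr
  have h0 : 0 ≤ (t + 1) * r + 1 / 2 := by
    have := mul_nonneg (by linarith [ht.1] : 0 ≤ t + 1) hr'.le
    linarith
  have h1 := Nat.floor_le h0
  have h2 := Nat.lt_floor_add_one ((t + 1) * r + 1 / 2)
  have h3 : ⌊(t + 1) * (r : ℝ) + 1 / 2⌋₊ ≤ 2 * r := by
    rw [← Nat.lt_succ_iff, Nat.floor_lt h0]
    push_cast
    nlinarith [ht.2]
  unfold gidx gval
  rw [min_eq_left h3]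
  generalize ((⌊(t + 1) * (r : ℝ) + 1 / 2⌋₊ : ℕ) : ℝ) = f at *
  have e : t - (f / r - 1) = ((t + 1) * r - f) / r := by field_simp; ring
  rw [e, abs_div, abs_of_pos hr']
  gcongr
  rw [abs_le]; constructor <;> linarith

theorem gidx_eq {r : ℕ} (hr : 0 < r) {t : ℝ} {j : ℕ} (hj : j ≤ 2 * r)
    (h : |t - gval r j| < 1 / (2 * r)) : gidx r t = j := by
  have hr' : (0 : ℝ) < r := by exact_mod_cast hr
  unfold gval at h
  have e : t - ((j : ℝ) / r - 1) = ((t + 1) * r - j) / r := by field_simp; ring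
  rw [e, abs_div, abs_of_pos hr', div_lt_div_iff₀ hr' (by positivity)] at h
  have h' : |(t + 1) * r - j| < 1 / 2 := by
    by_contra hc
    push Not at hc
    nlinarith
  rw [abs_lt] at h'
  unfold gidx
  have : ⌊(t + 1) * (r : ℝ) + 1 / 2⌋₊ = j := by
    rw [Nat.floor_eq_iff (by linarith [h'.1, (Nat.cast_nonneg j : (0 : ℝ) ≤ j)])]
    constructor <;> linarith [h'.1, h'.2]
  rw [this, min_eq_left hj]

theorem gval_mem {r : ℕ} (hr : 0 < r) {j : ℕ} (hj : j ≤ 2 * r) : gval r j ∈ Icc (-1 : ℝ) 1 := by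
  have hr' : (0 : ℝ) < r := by exact_mod_cast hr
  unfold gval
  have h1 : (0 : ℝ) ≤ (j : ℝ) / r := by positivity
  have h2 : (j : ℝ) / r ≤ 2 := by
    rw [div_le_iff₀ hr']; exact_mod_cast hj
  constructor <;> linarith

/-- rounding of a family to the grid -/
def gridF (r : ℕ) (F : ℕ → unitInterval → ℝ) : ℕ → unitInterval → ℝ :=
  fun i x => gval r (gidx r (F i x))

theorem gridF_admis {r : ℕ} (hr : 0 < r) {F : ℕ → unitInterval → ℝ} (hFA : Admis F) :
    Admis (gridF r F) := by
  intro i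
  refine ⟨?_, fun x => gval_mem hr (gidx_le _ _)⟩
  exact (measurable_from_nat (f := gval r)).comp ((gidx_measurable r).comp (hFA i).1)

/-- the vector of grid indices -/
def gvec (r K : ℕ) (F : ℕ → unitInterval → ℝ) (x : unitInterval) : Fin K → Fin (2 * r + 1) :=
  fun i => ⟨gidx r (F i x), Nat.lt_succ_of_le (gidx_le _ _)⟩

theorem gvec_measurable (r K : ℕ) {F : ℕ → unitInterval → ℝ} (hFA : Admis F) :
    Measurable (gvec r K F) := by
  refine measurable_pi_lambda _ fun i => ?_
  have h : Measurable fun x => gidx r (F i x) := (gidx_measurable r).comp (hFA i).1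
  refine measurable_to_countable' fun v => ?_
  have : (fun x => gvec r K F x i) ⁻¹' {v} = (fun x => gidx r (F i x)) ⁻¹' {(v : ℕ)} := by
    ext x; simp [gvec, Fin.ext_iff]
  change MeasurableSet ((fun x => gvec r K F x i) ⁻¹' {v})
  rw [this]
  exact h (measurableSet_singleton _)

theorem grid_compare {Ω₂ : Type*} [MeasurableSpace Ω₂] (P₂ : Measure Ω₂) [IsProbabilityMeasure P₂]
    {r : ℕ} (hr : 0 < r) (K : ℕ) {F G : ℕ → unitInterval → ℝ} (hFA : Admis F) (hGA : Admis G)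
    {W U : unitInterval × unitInterval × Ω₂ → ℝ} (hW : Measurable W) (hU : Measurable U)
    (δ : ℝ) (hδ : 0 < δ) (hδr : δ ≤ 1 / (2 * r))
    (h : levyProkhorovEDist
        (Smeasure (volume : Measure unitInterval) P₂ (fun i : Fin K => gridF r F i) W)
        (Smeasure (volume : Measure unitInterval) P₂ (fun i : Fin K => G i) U)
        < ENNReal.ofReal δ) (v : Fin K → Fin (2 * r + 1)) :
    (volume : Measure unitInterval).real {x | gvec r K F x = v} ≤
      (volume : Measure unitInterval).real {x | gvec r K G x = v} + δ := by
  set B : Set (RE (2 * K + 1)) := {y | ∀ i : Fin K, y ⟨2 * (i : ℕ), by omega⟩ = gval r (v i)} with hB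
  have hBm : MeasurableSet B := by
    have : IsClosed B := by
      rw [hB]
      simp only [ofPred_forall]
      refine isClosed_iInter fun i => ?_
      exact isClosed_eq (by fun_prop) continuous_const
    exact this.measurableSet
  have h1 := left_measure_le_of_levyProkhorovEDist_lt h hBm
  rw [ENNReal.toReal_ofReal hδ.le] at h1
  have hFm := sVec_measurable (fun i : Fin K => gridF r F i) (fun i => (gridF_admis hr hFA i).1) W hW
  have hGm := sVec_measurable (fun i : Fin K => G i) (fun i => (hGA i).1) U hU
  unfold Smeasure at h1
  rw [Measure.map_apply hFm hBm, Measure.map_apply hGm Metric.isOpen_thickening.measurableSet] at h1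
  have hA1 : MeasurableSet {x | gvec r K F x = v} := gvec_measurable r K hFA (measurableSet_singleton v)
  have hA2 : MeasurableSet {x | gvec r K G x = v} := gvec_measurable r K hGA (measurableSet_singleton v)
  have key : ∀ A : Set unitInterval, MeasurableSet A → nuM P₂ (Prod.fst ⁻¹' A) = volume A := by
    intro A hA
    exact (measurePreserving_fst (μ := (volume : Measure unitInterval))
      (ν := (volume : Measure unitInterval).prod P₂)).measure_preimage hA.nullMeasurableSet
  have s1 : Prod.fst ⁻¹' {x | gvec r K F x = v} ⊆
      sVec K (fun i : Fin K => gridF r F i) W ⁻¹' B := by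
    intro z hz i
    have hz' : gvec r K F z.1 = v := hz
    rw [sVec_even _ W z i i.2, ← hz']
    rfl
  have s2 : sVec K (fun i : Fin K => G i) U ⁻¹' (Metric.thickening δ B) ⊆
      Prod.fst ⁻¹' {x | gvec r K G x = v} := by
    intro z hz
    obtain ⟨y, hy, hd⟩ := Metric.mem_thickening_iff.1 hz
    change gvec r K G z.1 = v
    funext i
    apply Fin.ext
    change gidx r (G i z.1) = v i
    refine gidx_eq hr (Nat.le_of_lt_succ (v i).2) (lt_of_lt_of_le ?_ hδr)
    have h3 := PiLp.norm_apply_le (sVec K (fun i : Fin K => G i) U z - y) ⟨2 * (i : ℕ), by omega⟩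
    rw [dist_eq_norm] at hd
    rw [PiLp.sub_apply, sVec_even _ U z i i.2, hy i] at h3
    exact lt_of_le_of_lt h3 hd
  have h4 : volume {x | gvec r K F x = v} ≤ volume {x | gvec r K G x = v} + ENNReal.ofReal δ := by
    rw [← key _ hA1, ← key _ hA2]
    exact (measure_mono s1).trans (h1.trans (add_le_add_left (measure_mono s2) _))
  have h5 := ENNReal.toReal_mono (by finiteness) h4
  rw [ENNReal.toReal_add (by finiteness) (by finiteness), ENNReal.toReal_ofReal hδ.le] at h5
  exact h5

theorem match_profile {Ω₂ : Type*} [MeasurableSpace Ω₂] (P₂ : Measure Ω₂) [IsProbabilityMeasure P₂]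
    {r : ℕ} (hr : 0 < r) (K : ℕ) {F G : ℕ → unitInterval → ℝ} (hFA : Admis F) (hGA : Admis G)
    {W U : unitInterval × unitInterval × Ω₂ → ℝ} (hW : Measurable W) (hU : Measurable U)
    (δ : ℝ) (hδ : 0 < δ) (hδr : δ ≤ 1 / (2 * r))
    (h : levyProkhorovEDist
        (Smeasure (volume : Measure unitInterval) P₂ (fun i : Fin K => gridF r F i) W)
        (Smeasure (volume : Measure unitInterval) P₂ (fun i : Fin K => G i) U)
        < ENNReal.ofReal δ) (η : ℝ) (hη : 0 < η) :
    ∃ φ : unitInterval ≃ᵐ unitInterval, MeasurePreserving φ volume volume ∧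
      ∃ B : Set unitInterval, MeasurableSet B ∧ (volume : Measure unitInterval).real B ≤
        (2 * (r : ℝ) + 1) ^ K * δ + η ∧
        ∀ x ∉ B, ∀ i < K, |gridF r F i x - G i (φ x)| ≤ 1 / r := by
  obtain ⟨φ, hφ, hb⟩ := exists_matching (gvec r K F) (gvec r K G) (gvec_measurable r K hFA)
    (gvec_measurable r K hGA) δ η hδ.le hη
    (grid_compare P₂ hr K hFA hGA hW hU δ hδ hδr h)
  refine ⟨φ, hφ, {x | gvec r K F x ≠ gvec r K G (φ x)}, ?_, ?_, ?_⟩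
  · exact (measurableSet_eq_fun (gvec_measurable r K hFA)
      ((gvec_measurable r K hGA).comp φ.measurable)).compl
  · refine hb.trans (le_of_eq ?_)
    simp
  · intro x hx i hi
    have hx' : gvec r K F x = gvec r K G (φ x) := by
      by_contra hc; exact hx hc
    have := congrArg Fin.val (congrFun hx' ⟨i, hi⟩)
    change gidx r (F i x) = gidx r (G i (φ x)) at this
    unfold gridF
    rw [this, abs_sub_comm]
    exact gval_gidx hr ((hGA i).2 _)


theorem clampM_diff {M q : ℝ} (hM : 1 ≤ M) (hq : 1 < q) (t : ℝ) :
    |t - clampM M t| ≤ M ^ (-(q - 1)) * |t| ^ q := by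
  have hM0 : 0 < M := by linarith
  by_cases h : |t| ≤ M
  · have h' := abs_le.1 h
    have : clampM M t = t := by
      unfold clampM; rw [min_eq_right h'.2, max_eq_right h'.1]
    rw [this, sub_self, abs_zero]
    positivity
  · push Not at h
    have ht : 0 < |t| := hM0.trans h
    have h1 : |t - clampM M t| ≤ |t| := by
      unfold clampM
      rcases le_total 0 t with h0 | h0
      · rw [abs_of_nonneg h0] at h ⊢
        rw [min_eq_left h.le, max_eq_right (by linarith), abs_of_pos (by linarith)]
        linarith
      · rw [abs_of_nonpos h0] at h ⊢
        rw [min_eq_right (by linarith), max_eq_left (by linarith), abs_of_neg (by linarith)]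
        linarith
    refine h1.trans ?_
    have h2 : |t| ^ (-(q - 1)) ≤ M ^ (-(q - 1)) :=
      Real.rpow_le_rpow_of_nonpos hM0 h.le (by linarith)
    have h3 : |t| = |t| ^ (-(q - 1)) * |t| ^ q := by
      rw [← Real.rpow_add ht]
      have : -(q - 1) + q = 1 := by ring
      rw [this, Real.rpow_one]
    calc |t| = |t| ^ (-(q - 1)) * |t| ^ q := h3
      _ ≤ _ := by gcongr

theorem trunc_unif {Ω : Type*} [MeasurableSpace Ω] (μ : Measure Ω) [IsProbabilityMeasure μ]
    (p : ℝ≥0∞) (hp : 1 < p) (C : ℝ) (hC : 0 < C) (W : ℕ → Ω → ℝ) (hW : ∀ n, Measurable (W n))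
    (hbound : ∀ n, eLpNorm (W n) p μ ≤ ENNReal.ofReal C) (τ : ℝ) (hτ : 0 < τ) :
    ∃ M : ℝ, 1 ≤ M ∧ ∀ n, Integrable (W n) μ ∧ ∫ z, |W n z - clampM M (W n z)| ∂μ ≤ τ := by
  obtain ⟨q, hq1, hqp⟩ := ENNReal.lt_iff_exists_nnreal_btwn.1 hp
  have hq : (1 : ℝ) < q := by exact_mod_cast hq1
  have hq0 : (q : ℝ≥0∞) ≠ 0 := (zero_lt_one.trans hq1).ne'
  have hlim : Filter.Tendsto (fun M : ℝ => M ^ (-((q : ℝ) - 1)) * C ^ (q : ℝ)) Filter.atTop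
      (nhds (0 * C ^ (q : ℝ))) :=
    (tendsto_rpow_neg_atTop (by linarith)).mul_const _
  rw [zero_mul] at hlim
  obtain ⟨M, hM1, hM⟩ := ((hlim.eventually (gt_mem_nhds hτ)).and (Filter.eventually_ge_atTop 1)).exists
  refine ⟨M, hM, fun n => ?_⟩
  have hb : eLpNorm (W n) q μ ≤ ENNReal.ofReal C :=
    (eLpNorm_le_eLpNorm_of_exponent_le hqp.le (hW n).aestronglyMeasurable).trans (hbound n)
  have hmem : MemLp (W n) q μ := ⟨(hW n).aestronglyMeasurable, hb.trans_lt ENNReal.ofReal_lt_top⟩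
  have hIntg : Integrable (W n) μ := hmem.integrable hq1.le
  refine ⟨hIntg, ?_⟩
  have hqi := hmem.integrable_norm_rpow hq0 ENNReal.coe_ne_top
  rw [hmem.eLpNorm_eq_integral_rpow_norm hq0 ENNReal.coe_ne_top,
    ENNReal.ofReal_le_ofReal_iff hC.le] at hb
  simp only [ENNReal.coe_toReal, Real.norm_eq_abs] at hb hqi
  have hI : ∫ z, |W n z| ^ (q : ℝ) ∂μ ≤ C ^ (q : ℝ) := by
    have h0 : 0 ≤ ∫ z, |W n z| ^ (q : ℝ) ∂μ := integral_nonneg fun z => by positivity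
    rwa [Real.rpow_inv_le_iff_of_pos h0 hC.le (by linarith)] at hb
  calc ∫ z, |W n z - clampM M (W n z)| ∂μ
      ≤ ∫ z, M ^ (-((q : ℝ) - 1)) * |W n z| ^ (q : ℝ) ∂μ := by
        refine integral_mono_of_nonneg (Filter.Eventually.of_forall fun z => abs_nonneg _)
          (hqi.const_mul _) (Filter.Eventually.of_forall fun z => clampM_diff hM hq _)
    _ = M ^ (-((q : ℝ) - 1)) * ∫ z, |W n z| ^ (q : ℝ) ∂μ := integral_const_mul _ _
    _ ≤ M ^ (-((q : ℝ) - 1)) * C ^ (q : ℝ) := by gcongr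
    _ ≤ τ := hM1.le

section
variable {Ω₂ : Type*} [MeasurableSpace Ω₂]

/-- rectangle indicator -/
def rect {Ω₂ : Type*} (S T : Set unitInterval) (z : unitInterval × unitInterval × Ω₂) : ℝ :=
  S.indicator (fun _ => (1 : ℝ)) z.1 * T.indicator (fun _ => (1 : ℝ)) z.2.1

theorem rect_abs {Ω₂ : Type*} (S T : Set unitInterval) (z : unitInterval × unitInterval × Ω₂) :
    |rect S T z| ≤ 1 := by
  unfold rect
  by_cases h : z.1 ∈ S <;> by_cases h' : z.2.1 ∈ T <;> simp [h, h']

theorem rect_measurable {S T : Set unitInterval} (hS : MeasurableSet S) (hT : MeasurableSet T) :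
    Measurable (rect (Ω₂ := Ω₂) S T) :=
  ((measurable_const.indicator hS).comp measurable_fst).mul
    ((measurable_const.indicator hT).comp (measurable_fst.comp measurable_snd))

theorem rect_integrable {P₂ : Measure Ω₂} {S T : Set unitInterval} (hS : MeasurableSet S)
    (hT : MeasurableSet T) {U : unitInterval × unitInterval × Ω₂ → ℝ}
    (hU : Integrable U (nuM P₂)) : Integrable (fun z => U z * rect S T z) (nuM P₂) :=
  hU.mul_bdd (c := 1) (rect_measurable hS hT).aestronglyMeasurable
    (Filter.Eventually.of_forall fun z => by simpa using rect_abs S T z)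

theorem rect_int_le {P₂ : Measure Ω₂} {S T : Set unitInterval} (hS : MeasurableSet S)
    (hT : MeasurableSet T) {U : unitInterval × unitInterval × Ω₂ → ℝ}
    (hU : Integrable U (nuM P₂)) :
    |∫ z, U z * rect S T z ∂(nuM P₂)| ≤ ∫ z, |U z| ∂(nuM P₂) := by
  refine (abs_integral_le_integral_abs).trans ?_
  refine integral_mono (rect_integrable hS hT hU).abs hU.abs fun z => ?_
  simp only [abs_mul]
  exact mul_le_of_le_one_right (abs_nonneg _) (rect_abs S T z)

theorem contraction_integrable (P₂ : Measure Ω₂) [IsProbabilityMeasure P₂]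
    {U : unitInterval × unitInterval × Ω₂ → ℝ} (hU : Integrable U (nuM P₂)) :
    Integrable (contraction P₂ U) ((volume : Measure unitInterval).prod volume) := by
  have hmp : MeasurePreserving (MeasurableEquiv.prodAssoc (α := unitInterval) (β := unitInterval)
      (γ := Ω₂)) (((volume : Measure unitInterval).prod volume).prod P₂) (nuM P₂) :=
    ⟨MeasurableEquiv.measurable _, Measure.prodAssoc_prod⟩
  have h := (hmp.integrable_comp_emb (MeasurableEquiv.measurableEmbedding _)).2 hU
  exact h.integral_prod_left

theorem contraction_rect (P₂ : Measure Ω₂) [IsProbabilityMeasure P₂]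
    {U : unitInterval × unitInterval × Ω₂ → ℝ} (hU : Integrable U (nuM P₂))
    {S T : Set unitInterval} (hS : MeasurableSet S) (hT : MeasurableSet T) :
    ∫ x in S ×ˢ T, contraction P₂ U x ∂((volume : Measure unitInterval).prod volume)
      = ∫ z, U z * rect S T z ∂(nuM P₂) := by
  have hmp : MeasurePreserving (MeasurableEquiv.prodAssoc (α := unitInterval) (β := unitInterval)
      (γ := Ω₂)) (((volume : Measure unitInterval).prod volume).prod P₂) (nuM P₂) :=
    ⟨MeasurableEquiv.measurable _, Measure.prodAssoc_prod⟩
  have h := (hmp.integrable_comp_emb (MeasurableEquiv.measurableEmbedding _)).2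
    (rect_integrable hS hT hU)
  rw [← hmp.integral_comp (MeasurableEquiv.measurableEmbedding _),
    ← integral_indicator (hS.prod hT)]
  have hpr := integral_prod _ h
  refine Eq.trans ?_ hpr.symm
  refine integral_congr_ae (Filter.Eventually.of_forall fun x => ?_)
  have e : ∀ ω : Ω₂, rect S T ((MeasurableEquiv.prodAssoc (α := unitInterval)
      (β := unitInterval) (γ := Ω₂)) (x, ω)) =
      (S ×ˢ T).indicator (fun _ => (1 : ℝ)) x := by
    intro ω
    change S.indicator (fun _ => (1 : ℝ)) x.1 * T.indicator (fun _ => (1 : ℝ)) x.2 = _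
    by_cases h : x.1 ∈ S <;> by_cases h' : x.2 ∈ T <;> simp [h, h', indicator]
  simp only [Function.comp, e]
  rw [integral_mul_const]
  by_cases h : x ∈ S ×ˢ T
  · rw [indicator_of_mem h, indicator_of_mem h, mul_one]; rfl
  · rw [indicator_of_notMem h, indicator_of_notMem h, mul_zero]

/-- the diagonal action of a bijection of the interval -/
def dact {Ω₂ : Type*} [MeasurableSpace Ω₂] (φ : unitInterval ≃ᵐ unitInterval) :
    (unitInterval × unitInterval × Ω₂) ≃ᵐ (unitInterval × unitInterval × Ω₂) :=
  φ.prodCongr (φ.prodCongr (MeasurableEquiv.refl Ω₂))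

theorem dact_mp (P₂ : Measure Ω₂) [IsProbabilityMeasure P₂] (φ : unitInterval ≃ᵐ unitInterval)
    (hφ : MeasurePreserving φ volume volume) :
    MeasurePreserving (dact (Ω₂ := Ω₂) φ) (nuM P₂) (nuM P₂) :=
  hφ.prod (hφ.prod (MeasurePreserving.id P₂))

theorem rect_dact (P₂ : Measure Ω₂) [IsProbabilityMeasure P₂] (φ : unitInterval ≃ᵐ unitInterval)
    (hφ : MeasurePreserving φ volume volume) (U : unitInterval × unitInterval × Ω₂ → ℝ)
    (S T : Set unitInterval) :
    ∫ z, U (dact φ z) * rect S T z ∂(nuM P₂) =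
      ∫ z, U z * rect (φ.symm ⁻¹' S) (φ.symm ⁻¹' T) z ∂(nuM P₂) := by
  rw [← (dact_mp P₂ φ hφ).integral_comp (MeasurableEquiv.measurableEmbedding _)
    (fun z => U z * rect (φ.symm ⁻¹' S) (φ.symm ⁻¹' T) z)]
  refine integral_congr_ae (Filter.Eventually.of_forall fun z => ?_)
  have e : rect (φ.symm ⁻¹' S) (φ.symm ⁻¹' T) (dact φ z) = rect S T z := by
    change (φ.symm ⁻¹' S).indicator (fun _ => (1 : ℝ)) (φ z.1) *
      (φ.symm ⁻¹' T).indicator (fun _ => (1 : ℝ)) (φ z.2.1) = _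
    have hx : ∀ (A : Set unitInterval) (x : unitInterval), φ x ∈ φ.symm ⁻¹' A ↔ x ∈ A := by
      intro A x; rw [mem_preimage, φ.symm_apply_apply]
    unfold rect
    by_cases h : z.1 ∈ S <;> by_cases h' : z.2.1 ∈ T <;>
      simp only [indicator, hx, h, h', if_true, if_false]
  simp only [e]

theorem hF_match (P₂ : Measure Ω₂) [IsProbabilityMeasure P₂] {a : ℝ} (ha : 0 ≤ a) (k : ℕ)
    {F G : ℕ → unitInterval → ℝ} (hFA : Admis F) (hGA : Admis G)
    (φ : unitInterval ≃ᵐ unitInterval) (B : Set unitInterval) (hB : MeasurableSet B) (τ β : ℝ)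
    (hτ : 0 ≤ τ)
    (hβ : (volume : Measure unitInterval).real B ≤ β)
    (h : ∀ x ∉ B, ∀ i < 2 * k, |F i x - G i (φ x)| ≤ τ) :
    Integrable (fun z : unitInterval × unitInterval × Ω₂ =>
      hF a k F z.1 z.2.1 - hF a k G (φ z.1) (φ z.2.1)) (nuM P₂) ∧
    ∫ z, |hF a k F z.1 z.2.1 - hF a k G (φ z.1) (φ z.2.1)| ∂(nuM P₂) ≤
      2 * a * k * τ + 4 * a * k * β := by
  have hm : Measurable (fun z : unitInterval × unitInterval × Ω₂ =>
      hF a k F z.1 z.2.1 - hF a k G (φ z.1) (φ z.2.1)) :=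
    (hF_measurable3 a k hFA).sub ((hF_measurable3 a k hGA).comp (dact φ).measurable)
  have hak : 0 ≤ a * k := by positivity
  have hbd : ∀ z : unitInterval × unitInterval × Ω₂,
      |hF a k F z.1 z.2.1 - hF a k G (φ z.1) (φ z.2.1)| ≤ 2 * (a * k) := by
    intro z
    refine (abs_sub _ _).trans ?_
    linarith [hF_abs ha k hFA z.1 z.2.1, hF_abs ha k hGA (φ z.1) (φ z.2.1)]
  have hIntg : Integrable (fun z : unitInterval × unitInterval × Ω₂ =>
      hF a k F z.1 z.2.1 - hF a k G (φ z.1) (φ z.2.1)) (nuM P₂) :=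
    Integrable.of_bound hm.aestronglyMeasurable _ (Filter.Eventually.of_forall hbd)
  refine ⟨hIntg, ?_⟩
  set b : unitInterval → ℝ := B.indicator fun _ => 1 with hb
  have hbm : Measurable b := measurable_const.indicator hB
  have hbi : Integrable b (volume : Measure unitInterval) := (integrable_const _).indicator hB
  have hbv : ∫ x, b x = (volume : Measure unitInterval).real B := by
    rw [hb, integral_indicator hB]; simp
  have m1 : MeasurePreserving (fun z : unitInterval × unitInterval × Ω₂ => z.1) (nuM P₂) volume :=
    measurePreserving_fst
  have m2 : MeasurePreserving (fun z : unitInterval × unitInterval × Ω₂ => z.2.1) (nuM P₂) volume :=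
    measurePreserving_fst.comp measurePreserving_snd
  have i1 : Integrable (fun z : unitInterval × unitInterval × Ω₂ => b z.1) (nuM P₂) :=
    m1.integrable_comp_of_integrable hbi
  have i2 : Integrable (fun z : unitInterval × unitInterval × Ω₂ => b z.2.1) (nuM P₂) :=
    m2.integrable_comp_of_integrable hbi
  have e1 : ∫ z, b z.1 ∂(nuM P₂) = (volume : Measure unitInterval).real B := by
    rw [← hbv, ← m1.map_eq, integral_map m1.measurable.aemeasurable
      (by rw [m1.map_eq]; exact hbm.aestronglyMeasurable)]
  have e2 : ∫ z, b z.2.1 ∂(nuM P₂) = (volume : Measure unitInterval).real B := by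
    rw [← hbv, ← m2.map_eq, integral_map m2.measurable.aemeasurable
      (by rw [m2.map_eq]; exact hbm.aestronglyMeasurable)]
  have i12 : Integrable (fun z : unitInterval × unitInterval × Ω₂ => b z.1 + b z.2.1) (nuM P₂) :=
    i1.add i2
  calc _ ≤ ∫ z, (2 * a * k * τ + 2 * (a * k) * (b z.1 + b z.2.1)) ∂(nuM P₂) := by
        refine integral_mono hIntg.abs ((integrable_const _).add (i12.const_mul _)) fun z => ?_
        have hτ' : 0 ≤ 2 * a * k * τ := by positivity
        by_cases h1 : z.1 ∈ B
        · have n2 : 0 ≤ b z.2.1 := indicator_nonneg (fun _ _ => zero_le_one) _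
          have n1 : b z.1 = 1 := by simp [hb, h1]
          have := hbd z
          simp only [n1]
          nlinarith [mul_nonneg hak n2]
        · by_cases h2 : z.2.1 ∈ B
          · have n2 : b z.2.1 = 1 := by simp [hb, h2]
            have n1 : b z.1 = 0 := by simp [hb, h1]
            have := hbd z
            simp only [n1, n2]
            linarith
          · have n2 : b z.2.1 = 0 := by simp [hb, h2]
            have n1 : b z.1 = 0 := by simp [hb, h1]
            have := hF_diff ha k hFA hGA z.1 z.2.1 (φ z.1) (φ z.2.1) τ (h _ h1) (h _ h2)
            simp only [n1, n2]
            linarith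
    _ = 2 * a * k * τ + 2 * (a * k) * (2 * (volume : Measure unitInterval).real B) := by
        rw [integral_add (integrable_const _) (i12.const_mul _), integral_const_mul (2 * (a * (k : ℝ))),
          integral_add i1 i2, e1, e2]
        rw [integral_const, probReal_univ, one_smul]
        ring
    _ ≤ _ := by nlinarith
end


section
variable {Ω₂ : Type*} [MeasurableSpace Ω₂]

theorem hF_integrable3 (P₂ : Measure Ω₂) [IsProbabilityMeasure P₂] {a : ℝ} (ha : 0 ≤ a) (k : ℕ)
    {F : ℕ → unitInterval → ℝ} (hFA : Admis F) :
    Integrable (fun z : unitInterval × unitInterval × Ω₂ => hF a k F z.1 z.2.1) (nuM P₂) :=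
  Integrable.of_bound (hF_measurable3 a k hFA).aestronglyMeasurable _
    (Filter.Eventually.of_forall fun z => hF_abs ha k hFA z.1 z.2.1)

theorem clamp_integrable (P₂ : Measure Ω₂) [IsProbabilityMeasure P₂] {M : ℝ} (hM : 0 ≤ M)
    {W : unitInterval × unitInterval × Ω₂ → ℝ} (hW : Measurable W) :
    Integrable (fun z => clampM M (W z)) (nuM P₂) :=
  Integrable.of_bound ((clampM_measurable M).comp hW).aestronglyMeasurable _
    (Filter.Eventually.of_forall fun z => clampM_abs hM (W z))

theorem split_three (P₂ : Measure Ω₂) [IsProbabilityMeasure P₂] {a M : ℝ} (ha : 0 ≤ a)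
    (hM : 0 ≤ M) (k : ℕ) {F : ℕ → unitInterval → ℝ} (hFA : Admis F)
    {W : unitInterval × unitInterval × Ω₂ → ℝ} (hW : Measurable W) (hWi : Integrable W (nuM P₂))
    {S T : Set unitInterval} (hS : MeasurableSet S) (hT : MeasurableSet T) :
    |∫ z, W z * rect S T z ∂(nuM P₂) - ∫ z, hF a k F z.1 z.2.1 * rect S T z ∂(nuM P₂)| ≤
      ∫ z, |W z - clampM M (W z)| ∂(nuM P₂) + |resid P₂ a M k F W S T| := by
  have hc := clamp_integrable P₂ hM hW
  have hh := hF_integrable3 P₂ ha k hFA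
  have h1 : Integrable (fun z => W z - clampM M (W z)) (nuM P₂) := hWi.sub hc
  have h2 : Integrable (fun z => clampM M (W z) - hF a k F z.1 z.2.1) (nuM P₂) := hc.sub hh
  have hr : resid P₂ a M k F W S T
      = ∫ z, (clampM M (W z) - hF a k F z.1 z.2.1) * rect S T z ∂(nuM P₂) := rfl
  have e : ∫ z, W z * rect S T z ∂(nuM P₂) - ∫ z, hF a k F z.1 z.2.1 * rect S T z ∂(nuM P₂)
      = ∫ z, (W z - clampM M (W z)) * rect S T z ∂(nuM P₂) + resid P₂ a M k F W S T := by
    rw [hr, ← integral_sub (rect_integrable hS hT hWi) (rect_integrable hS hT hh),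
      ← integral_add (rect_integrable hS hT h1) (rect_integrable hS hT h2)]
    refine integral_congr_ae (Filter.Eventually.of_forall fun z => ?_)
    simp only
    ring
  rw [e]
  exact (abs_add_le _ _).trans (add_le_add (rect_int_le hS hT h1) le_rfl)

theorem cut_bound (P₂ : Measure Ω₂) [IsProbabilityMeasure P₂] {a M : ℝ} (ha : 0 ≤ a)
    (hM : 0 ≤ M) (k : ℕ) {F G : ℕ → unitInterval → ℝ} (hFA : Admis F) (hGA : Admis G)
    {W U : unitInterval × unitInterval × Ω₂ → ℝ} (hW : Measurable W) (hU : Measurable U)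
    (hWi : Integrable W (nuM P₂)) (hUi : Integrable U (nuM P₂)) (t b c : ℝ)
    (htW : ∫ z, |W z - clampM M (W z)| ∂(nuM P₂) ≤ t)
    (htU : ∫ z, |U z - clampM M (U z)| ∂(nuM P₂) ≤ t)
    (hrW : ∀ S T, MeasurableSet S → MeasurableSet T → |resid P₂ a M k F W S T| ≤ b)
    (hrU : ∀ S T, MeasurableSet S → MeasurableSet T → |resid P₂ a M k G U S T| ≤ b)
    (φ : unitInterval ≃ᵐ unitInterval) (hφ : MeasurePreserving φ volume volume)
    (hi : Integrable (fun z : unitInterval × unitInterval × Ω₂ =>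
      hF a k F z.1 z.2.1 - hF a k G (φ z.1) (φ z.2.1)) (nuM P₂))
    (hc : ∫ z, |hF a k F z.1 z.2.1 - hF a k G (φ z.1) (φ z.2.1)| ∂(nuM P₂) ≤ c)
    {S T : Set unitInterval} (hS : MeasurableSet S) (hT : MeasurableSet T) :
    |∫ x in S ×ˢ T, (contraction P₂ W x - contraction P₂ U (φ x.1, φ x.2))
      ∂((volume : Measure unitInterval).prod volume)| ≤ 2 * t + 2 * b + c := by
  have hUφ : Integrable (fun z => U (dact φ z)) (nuM P₂) :=
    (dact_mp P₂ φ hφ).integrable_comp_of_integrable hUi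
  have e1 : ∀ x : unitInterval × unitInterval, contraction P₂ U (φ x.1, φ x.2)
      = contraction P₂ (fun z => U (dact φ z)) x := fun x => rfl
  simp only [e1]
  rw [integral_sub (contraction_integrable P₂ hWi).integrableOn
    (contraction_integrable P₂ hUφ).integrableOn, contraction_rect P₂ hWi hS hT,
    contraction_rect P₂ hUφ hS hT, rect_dact P₂ φ hφ U S T]
  have hS' : MeasurableSet (φ.symm ⁻¹' S) := φ.symm.measurable hS
  have hT' : MeasurableSet (φ.symm ⁻¹' T) := φ.symm.measurable hT
  have s1 := split_three P₂ ha hM k hFA hW hWi hS hT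
  have s2 := split_three P₂ ha hM k hGA hU hUi hS' hT'
  have r1 := hrW _ _ hS hT
  have r2 := hrU _ _ hS' hT'
  rw [← rect_dact P₂ φ hφ (fun z => hF a k G z.1 z.2.1) S T] at s2
  have hGφ : Integrable (fun z : unitInterval × unitInterval × Ω₂ =>
      hF a k G (φ z.1) (φ z.2.1)) (nuM P₂) :=
    (dact_mp P₂ φ hφ).integrable_comp_of_integrable (hF_integrable3 P₂ ha k hGA)
  have s3 := rect_int_le hS hT hi
  have e3 : ∫ z, (hF a k F z.1 z.2.1 - hF a k G (φ z.1) (φ z.2.1)) * rect S T z ∂(nuM P₂)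
      = ∫ z, hF a k F z.1 z.2.1 * rect S T z ∂(nuM P₂)
        - ∫ z, hF a k G (φ z.1) (φ z.2.1) * rect S T z ∂(nuM P₂) := by
    rw [← integral_sub (rect_integrable hS hT (hF_integrable3 P₂ ha k hFA))
      (rect_integrable hS hT hGφ)]
    refine integral_congr_ae (Filter.Eventually.of_forall fun z => ?_)
    simp only
    ring
  rw [e3] at s3
  change |_ - ∫ z, hF a k G (φ z.1) (φ z.2.1) * rect S T z ∂(nuM P₂)| ≤ _ at s2
  generalize (∫ z, hF a k G (φ z.1) (φ z.2.1) * rect S T z ∂(nuM P₂)) = X1 at *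
  generalize (∫ z, hF a k F z.1 z.2.1 * rect S T z ∂(nuM P₂)) = X2 at *
  generalize (∫ z, W z * rect S T z ∂(nuM P₂)) = X3 at *
  generalize (∫ z, U z * rect (φ.symm ⁻¹' S) (φ.symm ⁻¹' T) z ∂(nuM P₂)) = X4 at *
  have a1 := abs_le.1 (s1.trans (add_le_add htW r1))
  have a2 := abs_le.1 (s2.trans (add_le_add htU r2))
  have a3 := abs_le.1 (s3.trans hc)
  rw [abs_le]
  constructor <;> linarith [a1.1, a1.2, a2.1, a2.2, a3.1, a3.2]

theorem cutDistR_le (u w : unitInterval × unitInterval → ℝ) (φ : unitInterval ≃ᵐ unitInterval)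
    (hφ : MeasurePreserving φ (volume : Measure unitInterval) volume) (b : ℝ) (hb : 0 ≤ b)
    (h : ∀ S T : Set unitInterval, MeasurableSet S → MeasurableSet T →
      |∫ x in S ×ˢ T, (u x - w (φ x.1, φ x.2))
        ∂((volume : Measure unitInterval).prod volume)| ≤ b) : cutDistR u w ≤ b := by
  unfold cutDistR
  refine (ciInf_le ⟨0, ?_⟩ ⟨φ, hφ⟩).trans ?_
  · rintro _ ⟨ψ, rfl⟩
    exact Real.iSup_nonneg fun _ => abs_nonneg _
  · unfold cutNormR
    exact Real.iSup_le (fun p => h _ _ p.1.2 p.2.2) hb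

/-- maximal energy -/
def maxEn (P₂ : Measure Ω₂) (a M : ℝ) (k : ℕ) (W : unitInterval × unitInterval × Ω₂ → ℝ) : ℝ :=
  ⨆ F : {F : ℕ → unitInterval → ℝ // Admis F}, en P₂ a M k F.1 W

theorem admis_zero : Admis (fun _ _ => 0) := fun _ => ⟨measurable_const, fun _ => by simp⟩

theorem le_maxEn (P₂ : Measure Ω₂) [IsProbabilityMeasure P₂] {a M : ℝ} (ha : 0 ≤ a)
    (hM : 0 ≤ M) (k : ℕ) {F : ℕ → unitInterval → ℝ} (hFA : Admis F)
    {W : unitInterval × unitInterval × Ω₂ → ℝ} (hW : Measurable W) :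
    en P₂ a M k F W ≤ maxEn P₂ a M k W := by
  refine le_ciSup (f := fun F : {F : ℕ → unitInterval → ℝ // Admis F} => en P₂ a M k F.1 W)
    ⟨M ^ 2, ?_⟩ ⟨F, hFA⟩
  rintro _ ⟨F, rfl⟩
  exact en_le P₂ ha hM k F.2 hW

theorem maxEn_le {P₂ : Measure Ω₂} {a M : ℝ} {k : ℕ}
    {W : unitInterval × unitInterval × Ω₂ → ℝ} {b : ℝ}
    (h : ∀ F, Admis F → en P₂ a M k F W ≤ b) : maxEn P₂ a M k W ≤ b := by
  have : Nonempty {F : ℕ → unitInterval → ℝ // Admis F} := ⟨⟨_, admis_zero⟩⟩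
  exact ciSup_le fun F => h F.1 F.2

theorem exists_near_max {P₂ : Measure Ω₂} {a M : ℝ} {k : ℕ}
    {W : unitInterval × unitInterval × Ω₂ → ℝ} {η : ℝ} (hη : 0 < η) :
    ∃ F, Admis F ∧ maxEn P₂ a M k W - η ≤ en P₂ a M k F W := by
  by_contra! hc
  have := maxEn_le (P₂ := P₂) (a := a) (M := M) (k := k) (W := W) (b := maxEn P₂ a M k W - η)
    fun F hF => (hc F hF).le
  linarith

theorem level_choice (P₂ : Measure Ω₂) [IsProbabilityMeasure P₂] {a M : ℝ} (ha : 0 ≤ a)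
    (hM : 1 ≤ M)
    (W : ℕ → unitInterval × unitInterval × Ω₂ → ℝ) (hW : ∀ n, Measurable (W n))
    (hcauchy : ∀ ε > (0 : ℝ), ∃ N : ℕ, ∀ m ≥ N, ∀ n ≥ N,
      dM (PVar.ofUnitInterval P₂ (W m) (hW m))
         (PVar.ofUnitInterval P₂ (W n) (hW n)) < ε) (η : ℝ) (hη : 0 < η) :
    ∃ k N, ∀ m ≥ N, ∀ n ≥ N, maxEn P₂ a M (k + 1) (W m) ≤ maxEn P₂ a M k (W n) + η := by
  have hM0 : 0 ≤ M := by linarith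
  refine energy_level (fun k n => maxEn P₂ a M k (W n)) (M ^ 2) (fun n => ?_) (fun k n => ?_)
    (fun k η hη => ?_) η hη
  · refine le_trans (le_of_eq ?_) (le_maxEn P₂ ha hM0 0 admis_zero (hW n))
    simp [en, enI, hF]
  · exact maxEn_le fun F hFA => en_le P₂ ha hM0 k hFA (hW n)
  · obtain ⟨δ, hδ, hcl⟩ := en_close P₂ (a := a) hM k η hη
    obtain ⟨N, hN⟩ := profile_close P₂ W hW hcauchy (2 * k) δ hδ
    refine ⟨N, fun m hm n hn => maxEn_le fun F hFA => ?_⟩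
    obtain ⟨G, hGA, hlt⟩ := hN m hm n hn F hFA
    exact (hcl δ hδ le_rfl (W m) (W n) (hW m) (hW n) F G hFA hGA hlt).trans
      (add_le_add (le_maxEn P₂ ha hM0 k hGA (hW n)) le_rfl)

end

/-- If a sequence of P-variables `W_n` on `[0,1] × [0,1] × Ω₂`
satisfies `‖W_n‖_p ≤ C` for some `1 < p ≤ ∞` and is Cauchy for the P-variables metric
`d_M`, then the sequence of contractions `w_n` is Cauchy for the real-valued cut
distance `δ_{□,ℝ}`. -/
theorem contractions_cutDistR_cauchy_of_dM_cauchy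
    {Ω₂ : Type*} [MeasurableSpace Ω₂] (P₂ : Measure Ω₂) [IsProbabilityMeasure P₂]
    (p : ℝ≥0∞) (hp : 1 < p) (C : ℝ) (hC : 0 < C)
    (W : ℕ → unitInterval × unitInterval × Ω₂ → ℝ) (hW : ∀ n, Measurable (W n))
    (hbound : ∀ n, eLpNorm (W n) p
      (((volume : Measure unitInterval)).prod
        (((volume : Measure unitInterval)).prod P₂)) ≤ ENNReal.ofReal C)
    (hcauchy : ∀ ε > (0 : ℝ), ∃ N : ℕ, ∀ m ≥ N, ∀ n ≥ N,
      dM (PVar.ofUnitInterval P₂ (W m) (hW m))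
         (PVar.ofUnitInterval P₂ (W n) (hW n)) < ε) :
    ∀ ε > (0 : ℝ), ∃ N : ℕ, ∀ m ≥ N, ∀ n ≥ N,
      cutDistR (contraction P₂ (W m)) (contraction P₂ (W n)) < ε := by
  intro ε hε
  set a : ℝ := ε / 12 with ha_def
  have ha : 0 < a := by positivity
  obtain ⟨M, hM, htr⟩ := trunc_unif (nuM P₂) p hp C hC W hW hbound a ha
  have hM0 : 0 ≤ M := by linarith
  set η : ℝ := a ^ 2 / 4 with hη_def
  have hη : 0 < η := by positivity
  obtain ⟨k, N1, hk⟩ := level_choice P₂ ha.le hM W hW hcauchy η hη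
  obtain ⟨r0, hr0⟩ := exists_nat_gt ((2 * M + 2 * (a * k)) * (2 * a * k) / η + 2 * k)
  have hr1 : (2 * M + 2 * (a * k)) * (2 * a * k) / η < r0 := by
    have : (0 : ℝ) ≤ 2 * k := by positivity
    linarith
  have hr2 : (2 * k : ℝ) < r0 := by
    have : 0 ≤ (2 * M + 2 * (a * k)) * (2 * a * k) / η := by positivity
    linarith
  have hrp : (0 : ℝ) < r0 := lt_of_le_of_lt (by positivity) hr2
  have hr : 0 < r0 := by exact_mod_cast hrp
  obtain ⟨δ1, hδ1, hcl⟩ := en_close P₂ (a := a) hM k η hη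
  set L : ℝ := (2 * (r0 : ℝ) + 1) ^ (2 * k + 1) with hL
  have hLp : 0 < L := by positivity
  set δ : ℝ := min δ1 (min (1 / (2 * r0)) (1 / (8 * (k + 1) * L))) with hδ_def
  have hδ : 0 < δ := by
    refine lt_min hδ1 (lt_min ?_ ?_) <;> positivity
  have hδL : L * δ ≤ 1 / (8 * (k + 1)) := by
    have h1 : δ ≤ 1 / (8 * (k + 1) * L) := (min_le_right _ _).trans (min_le_right _ _)
    calc L * δ ≤ L * (1 / (8 * (k + 1) * L)) := by gcongr
      _ = 1 / (8 * (k + 1)) := by field_simp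
  obtain ⟨N2, hN2⟩ := profile_close P₂ W hW hcauchy (2 * k) δ hδ
  refine ⟨max N1 N2, fun m hm n hn => ?_⟩
  have hm1 := (le_max_left _ _).trans hm
  have hn1 := (le_max_left _ _).trans hn
  obtain ⟨F, hFA, hFm⟩ := exists_near_max (P₂ := P₂) (a := a) (M := M) (k := k) (W := W m) hη
  have hgA := gridF_admis hr hFA
  obtain ⟨G, hGA, hlt⟩ := hN2 m ((le_max_right _ _).trans hm) n ((le_max_right _ _).trans hn)
    (gridF r0 F) hgA
  have hen1 := en_perturb P₂ ha.le hM0 k hFA hgA (hW m) (1 / r0)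
    fun i x => gval_gidx hr ((hFA i).2 x)
  have hpe : (2 * M + 2 * (a * k)) * (2 * a * k * (1 / r0)) ≤ η := by
    rw [div_lt_iff₀ hη] at hr1
    have : (2 * M + 2 * (a * k)) * (2 * a * k * (1 / r0))
      = (2 * M + 2 * (a * k)) * (2 * a * k) / r0 := by ring
    rw [this, div_le_iff₀ hrp]
    linarith
  have hen2 := hcl δ hδ (min_le_left _ _) (W m) (W n) (hW m) (hW n) _ G hgA hGA hlt
  obtain ⟨φ, hφ, B, hB, hBv, hBd⟩ := match_profile P₂ hr (2 * k + 1) hFA hGA (hW m) (hW n) δ hδ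
    ((min_le_right _ _).trans (min_le_left _ _)) hlt (1 / (8 * (k + 1))) (by positivity)
  have hβ : (volume : Measure unitInterval).real B ≤ 2 * (1 / (8 * ((k : ℝ) + 1))) := by
    linarith
  obtain ⟨hi, hc⟩ := hF_match P₂ ha.le k hgA hGA φ B hB (1 / r0) _ (by positivity) hβ
    fun x hx i hik => hBd x hx i (by omega)
  have hc1 : 2 * a * k * (1 / r0) ≤ a := by
    rw [mul_one_div, div_le_iff₀ hrp]
    nlinarith
  have hc2 : 4 * a * k * (2 * (1 / (8 * ((k : ℝ) + 1)))) ≤ a := by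
    have : 4 * a * k * (2 * (1 / (8 * ((k : ℝ) + 1)))) = a * k / (k + 1) := by field_simp; ring
    rw [this, div_le_iff₀ (by positivity)]
    nlinarith
  have hkm := hk m hm1 m hm1
  have hkn := hk n hn1 m hm1
  have hrW : ∀ S T, MeasurableSet S → MeasurableSet T →
      |resid P₂ a M k (gridF r0 F) (W m) S T| ≤ a := fun S T hS hT =>
    resid_bound P₂ ha hM0 k hgA (hW m) hS hT (maxEn P₂ a M (k + 1) (W m))
      (fun F' hF' => le_maxEn P₂ ha.le hM0 (k + 1) hF' (hW m)) (by linarith)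
  have hrU : ∀ S T, MeasurableSet S → MeasurableSet T →
      |resid P₂ a M k G (W n) S T| ≤ a := fun S T hS hT =>
    resid_bound P₂ ha hM0 k hGA (hW n) hS hT (maxEn P₂ a M (k + 1) (W n))
      (fun F' hF' => le_maxEn P₂ ha.le hM0 (k + 1) hF' (hW n)) (by linarith)
  have hfin := cutDistR_le (contraction P₂ (W m)) (contraction P₂ (W n)) φ hφ
    (2 * a + 2 * a + (a + a)) (by positivity) fun S T hS hT =>
    cut_bound P₂ ha.le hM0 k hgA hGA (hW m) (hW n) (htr m).1 (htr n).1 a a (a + a) (htr m).2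
      (htr n).2 hrW hrU φ hφ hi (hc.trans (add_le_add hc1 hc2)) hS hT
  refine lt_of_le_of_lt hfin ?_
  rw [ha_def]
  linarith

end
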